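/- arXiv:1303.4661 — 4 statements merged into one kernel-verified Lean document; each statement's English description precedes it below -/
import Mathlib

section
/- For every complex-valued Schwartz function φ on ℝ², the limit L := lim_{ε→0⁺} ∫_{ℝ²} φ(x,y)/((x+iε)(x+y+iε)) dx dy exists, and lim_{t→+∞} (1/t) ∫_{ℝ²} (∫₀ᵗ ∫₀^{t₁} ∫₀^{t₂} e^{ixt₁} e^{iyt₂} e^{−i(x+y)t₃} dt₃ dt₂ dt₁) φ(x,y) dx dy = −L. In other words, as tempered distributions in (x,y), the iterated time integral divided by t converges to −1/((x+i0)(x+y+i0)) as t → +∞. -/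
open MeasureTheory Filter

/-- The Fourier transform of a Schwartz function on the plane, in the coordinates dual to
`(x, x + y)`, is a Schwartz function. -/
lemma exists_schwartzMap_eq_integral_exp_mul (φ : SchwartzMap (ℝ × ℝ) ℂ) :
    ∃ F : SchwartzMap (ℝ × ℝ) ℂ, ∀ q : ℝ × ℝ, F q = ∫ p : ℝ × ℝ,
      Complex.exp (Complex.I * ((p.1 * q.1 + (p.1 + p.2) * q.2 : ℝ) : ℂ)) * φ p := by
  have hpi : Real.pi ≠ 0 := Real.pi_ne_zero
  let G : (ℝ × ℝ) ≃ₗ[ℝ] ℂ :=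
    { toFun := fun q => ⟨-(q.1 + q.2) / (2 * Real.pi), -q.2 / (2 * Real.pi)⟩
      invFun := fun z => (-(2 * Real.pi) * (z.re - z.im), -(2 * Real.pi) * z.im)
      map_add' := fun a b => by apply Complex.ext <;> simp <;> ring
      map_smul' := fun c a => by apply Complex.ext <;> simp <;> ring
      left_inv := fun q => by ext <;> (simp; field_simp); ring
      right_inv := fun z => by apply Complex.ext <;> simp <;> field_simp; ring }
  let ψ : SchwartzMap ℂ ℂ :=
    SchwartzMap.compCLMOfContinuousLinearEquiv ℂ Complex.equivRealProdCLM φ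
  refine ⟨SchwartzMap.compCLMOfContinuousLinearEquiv ℂ G.toContinuousLinearEquiv
    (FourierTransform.fourier ψ), fun q => ?_⟩
  rw [← Complex.volume_preserving_equiv_real_prod.integral_comp']
  simp only [SchwartzMap.compCLMOfContinuousLinearEquiv_apply, SchwartzMap.fourier_coe,
    Function.comp_apply, Real.fourier_eq', smul_eq_mul]
  congr 1 with z
  have h : -2 * Real.pi * inner ℝ z (G.toContinuousLinearEquiv q) =
      z.re * q.1 + (z.re + z.im) * q.2 := by
    simp [G, Complex.inner]
    field_simp
    ring
  rw [h, mul_comm Complex.I]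
  rfl

lemma integrable_indicator_of_subset_isCompact {α : Type*} [MeasurableSpace α] [TopologicalSpace α]
    [OpensMeasurableSpace α] {μ : Measure α} [IsFiniteMeasureOnCompacts μ] [T2Space α]
    {f : α → ℂ} (hf : Continuous f) {K S : Set α} (hK : IsCompact K) (hS : MeasurableSet S)
    (hSK : S ⊆ K) : Integrable (S.indicator f) μ :=
  (integrable_indicator_iff hS).2 ((hf.continuousOn.integrableOn_compact hK).mono_set hSK)

/-- In the variables `s = t₁ - t₂` and `r = t₂ - t₃`, the integral over `0 ≤ t₃ ≤ t₂ ≤ t₁ ≤ t`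
becomes a weighted integral over the quadrant. -/
lemma integral_simplex_eq_setIntegral_quadrant {g : ℝ × ℝ → ℂ} (hg : Continuous g)
    {t : ℝ} (ht : 0 ≤ t) :
    ∫ t₁ in (0:ℝ)..t, ∫ t₂ in (0:ℝ)..t₁, ∫ t₃ in (0:ℝ)..t₂, g (t₁ - t₂, t₂ - t₃) =
      ∫ q in Set.Ioi (0:ℝ) ×ˢ Set.Ioi (0:ℝ), ((max 0 (t - q.1 - q.2) : ℝ) : ℂ) * g q := by
  have hsub (u : ℝ) : ∫ t₂ in (0:ℝ)..u, ∫ t₃ in (0:ℝ)..t₂, g (u - t₂, t₂ - t₃) =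
      ∫ s in (0:ℝ)..u, ∫ r in (0:ℝ)..u - s, g (s, r) := by
    have h1 (t₂ : ℝ) : ∫ t₃ in (0:ℝ)..t₂, g (u - t₂, t₂ - t₃) =
        ∫ r in (0:ℝ)..t₂, g (u - t₂, r) := by
      simpa using intervalIntegral.integral_comp_sub_left (a := 0) (b := t₂)
        (fun r => g (u - t₂, r)) t₂
    simp only [h1]
    simpa using intervalIntegral.integral_comp_sub_left (a := 0) (b := u)
        (fun s => ∫ r in (0:ℝ)..u - s, g (s, r)) u
  let S : Set (ℝ × (ℝ × ℝ)) := {z | 0 < z.2.1 ∧ 0 < z.2.2 ∧ z.2.1 + z.2.2 ≤ z.1 ∧ z.1 ≤ t}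
  have hS : MeasurableSet S := by
    have m1 : Measurable fun z : ℝ × (ℝ × ℝ) => z.1 := by fun_prop
    have m2 : Measurable fun z : ℝ × (ℝ × ℝ) => z.2.1 := by fun_prop
    have m3 : Measurable fun z : ℝ × (ℝ × ℝ) => z.2.2 := by fun_prop
    exact (measurableSet_lt measurable_const m2).inter ((measurableSet_lt measurable_const m3).inter
      ((measurableSet_le (m2.add m3) m1).inter (measurableSet_le m1 measurable_const)))
  have hint : Integrable (S.indicator fun z => g z.2) (volume.prod volume) := by
    refine integrable_indicator_of_subset_isCompact (by fun_prop)
      (K := Set.Icc 0 t ×ˢ (Set.Icc 0 t ×ˢ Set.Icc 0 t))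
      (isCompact_Icc.prod (isCompact_Icc.prod isCompact_Icc)) hS ?_
    rintro ⟨u, s, r⟩ ⟨h1, h2, h3, h4⟩
    dsimp only at h1 h2 h3 h4
    simp only [Set.mem_prod, Set.mem_Icc]
    refine ⟨⟨?_, ?_⟩, ⟨?_, ?_⟩, ?_, ?_⟩ <;> linarith
  have hslice (u : ℝ) : Integrable (fun q : ℝ × ℝ => S.indicator (fun z => g z.2) (u, q))
      (volume.prod volume) := by
    have : (fun q : ℝ × ℝ => S.indicator (fun z => g z.2) (u, q)) =
        (Prod.mk u ⁻¹' S).indicator g := by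
      ext q; rfl
    rw [this]
    refine integrable_indicator_of_subset_isCompact hg (K := Set.Icc 0 t ×ˢ Set.Icc 0 t)
      (isCompact_Icc.prod isCompact_Icc) (measurable_prodMk_left hS) ?_
    rintro ⟨s, r⟩ ⟨h1, h2, h3, h4⟩
    dsimp only at h1 h2 h3 h4
    simp only [Set.mem_prod, Set.mem_Icc]
    refine ⟨⟨?_, ?_⟩, ?_, ?_⟩ <;> linarith
  have hleft : ∫ u in (0:ℝ)..t, ∫ s in (0:ℝ)..u, ∫ r in (0:ℝ)..u - s, g (s, r) =
      ∫ u, ∫ q : ℝ × ℝ, S.indicator (fun z => g z.2) (u, q) := by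
    rw [intervalIntegral.integral_of_le ht, ← integral_indicator measurableSet_Ioc]
    congr 1 with u
    rw [Measure.volume_eq_prod, integral_prod _ (hslice u)]
    by_cases hu : u ∈ Set.Ioc 0 t
    · rw [Set.indicator_of_mem hu, intervalIntegral.integral_of_le hu.1.le,
        ← integral_indicator measurableSet_Ioc]
      congr 1 with s
      by_cases hs : s ∈ Set.Ioc 0 u
      · rw [Set.indicator_of_mem hs, intervalIntegral.integral_of_le (by linarith [hs.2]),
          ← integral_indicator measurableSet_Ioc]
        congr 1 with r
        by_cases hr : r ∈ Set.Ioc 0 (u - s)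
        · rw [Set.indicator_of_mem hr, Set.indicator_of_mem]
          exact ⟨hs.1, hr.1, by dsimp only; linarith [hr.2], hu.2⟩
        · rw [Set.indicator_of_notMem hr, Set.indicator_of_notMem]
          rintro ⟨h1, h2, h3, h4⟩
          dsimp only at h1 h2 h3 h4
          exact hr ⟨h2, by linarith⟩
      · rw [Set.indicator_of_notMem hs]
        refine (integral_eq_zero_of_ae (.of_forall fun r => Set.indicator_of_notMem ?_ _)).symm
        rintro ⟨h1, h2, h3, h4⟩
        dsimp only at h1 h2 h3 h4
        exact hs ⟨h1, by linarith⟩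
    · rw [Set.indicator_of_notMem hu]
      refine (integral_eq_zero_of_ae (.of_forall fun s =>
        integral_eq_zero_of_ae (.of_forall fun r => Set.indicator_of_notMem ?_ _))).symm
      rintro ⟨h1, h2, h3, h4⟩
      dsimp only at h1 h2 h3 h4
      exact hu ⟨by linarith, h4⟩
  simp only [hsub]
  rw [hleft, integral_integral_swap (f := fun u q => S.indicator (fun z => g z.2) (u, q)) hint,
    ← integral_indicator (measurableSet_Ioi.prod measurableSet_Ioi)]
  congr 1 with q
  by_cases hq : q ∈ Set.Ioi (0:ℝ) ×ˢ Set.Ioi (0:ℝ)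
  · rw [Set.indicator_of_mem hq]
    have : (fun u : ℝ => S.indicator (fun z => g z.2) (u, q)) =
        (Set.Icc (q.1 + q.2) t).indicator fun _ => g q := by
      ext u
      refine Set.indicator_eq_indicator ⟨fun h => h.2.2, fun h => ⟨hq.1, hq.2, h⟩⟩ rfl
    rw [this, integral_indicator measurableSet_Icc, setIntegral_const, Real.volume_real_Icc,
      max_comm, sub_sub, Complex.real_smul]
  · rw [Set.indicator_of_notMem hq]
    exact integral_eq_zero_of_ae (.of_forall fun u =>
      Set.indicator_of_notMem (fun h => hq ⟨h.1, h.2.1⟩) _)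

/-- Fubini: pairing `φ` with a superposition of characters is integrating the transform of `φ`. -/
lemma integral_integral_mul_exp_mul (φ F : SchwartzMap (ℝ × ℝ) ℂ)
    (hF : ∀ q : ℝ × ℝ, F q = ∫ p : ℝ × ℝ,
      Complex.exp (Complex.I * ((p.1 * q.1 + (p.1 + p.2) * q.2 : ℝ) : ℂ)) * φ p)
    {μ : Measure (ℝ × ℝ)} [SFinite μ] {w : ℝ × ℝ → ℂ} (hw : Integrable w μ) :
    ∫ p : ℝ × ℝ, (∫ q, w q *
      Complex.exp (Complex.I * ((p.1 * q.1 + (p.1 + p.2) * q.2 : ℝ) : ℂ)) ∂μ) * φ p =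
      ∫ q, w q * F q ∂μ := by
  simp only [hF, ← integral_mul_const, ← integral_const_mul]
  rw [integral_integral_swap]
  · simp only [mul_assoc]
  · refine ((φ.integrable (μ := volume)).mul_prod hw).bdd_mul (c := 1)
      (f := fun z : (ℝ × ℝ) × (ℝ × ℝ) => Complex.exp (Complex.I *
        ((z.1.1 * z.2.1 + (z.1.1 + z.1.2) * z.2.2 : ℝ) : ℂ)))
      (Continuous.aestronglyMeasurable (by fun_prop)) (.of_forall fun z => ?_) |>.congr
        (.of_forall fun z => ?_)
    · rw [mul_comm Complex.I, Complex.norm_exp_ofReal_mul_I]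
    · simp only [Function.uncurry]
      ring

lemma tendsto_integral_mul_of_norm_le_one {α ι : Type*} [MeasurableSpace α] {μ : Measure α}
    {l : Filter ι} [l.IsCountablyGenerated] {F : α → ℂ} (hF : Integrable F μ) {w : ι → α → ℂ}
    (hm : ∀ᶠ i in l, AEStronglyMeasurable (w i) μ)
    (hb : ∀ᶠ i in l, ∀ᵐ x ∂μ, ‖w i x‖ ≤ 1)
    (hlim : ∀ᵐ x ∂μ, Tendsto (fun i => w i x) l (nhds 1)) :
    Tendsto (fun i => ∫ x, w i x * F x ∂μ) l (nhds (∫ x, F x ∂μ)) := by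
  refine tendsto_integral_filter_of_dominated_convergence (fun x => ‖F x‖)
    (hm.mono fun i hi => hi.mul hF.1) (hb.mono fun i hi => hi.mono fun x hx => ?_) hF.norm
    (hlim.mono fun x hx => by simpa using hx.mul_const (F x))
  rw [norm_mul]
  exact mul_le_of_le_one_left (norm_nonneg _) hx

lemma integral_exp_quadrant {ε : ℝ} (hε : 0 < ε) (p : ℝ × ℝ) :
    ∫ q in Set.Ioi (0:ℝ) ×ˢ Set.Ioi (0:ℝ), Complex.exp (-(ε * (q.1 + q.2) : ℝ)) *
      Complex.exp (Complex.I * ((p.1 * q.1 + (p.1 + p.2) * q.2 : ℝ) : ℂ)) =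
    -(1 / (((p.1 : ℂ) + Complex.I * (ε : ℂ)) *
            ((p.1 : ℂ) + (p.2 : ℂ) + Complex.I * (ε : ℂ)))) := by
  have hone (x : ℝ) : ∫ s in Set.Ioi (0:ℝ), Complex.exp ((Complex.I * x - ε) * s) =
      Complex.I / (x + Complex.I * ε) := by
    rw [integral_exp_mul_complex_Ioi (by simpa using hε)]
    have h1 : Complex.I * x - ε ≠ 0 := fun h => hε.ne' (by simpa using congrArg Complex.re h)
    have h2 : x + Complex.I * ε ≠ 0 := fun h => hε.ne' (by simpa using congrArg Complex.im h)
    simp only [Complex.ofReal_zero, mul_zero, Complex.exp_zero]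
    rw [div_eq_div_iff h1 h2]
    linear_combination (-x : ℂ) * Complex.I_sq
  have key := setIntegral_prod_mul (μ := volume) (ν := volume)
    (fun s : ℝ => Complex.exp ((Complex.I * p.1 - ε) * s))
    (fun r : ℝ => Complex.exp ((Complex.I * (p.1 + p.2 : ℝ) - ε) * r))
    (Set.Ioi 0) (Set.Ioi 0)
  rw [hone, hone, div_mul_div_comm, Complex.I_mul_I] at key
  rw [← neg_div, Measure.volume_eq_prod]
  push_cast at key ⊢
  rw [← key]
  congr 1 with q
  rw [← Complex.exp_add, ← Complex.exp_add]
  ring_nf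

lemma integrableOn_exp_quadrant {ε : ℝ} (hε : 0 < ε) :
    IntegrableOn (fun q : ℝ × ℝ => Complex.exp (-(ε * (q.1 + q.2) : ℝ)))
      (Set.Ioi (0:ℝ) ×ˢ Set.Ioi (0:ℝ)) := by
  have h : IntegrableOn (fun s : ℝ => Complex.exp (-ε * s)) (Set.Ioi 0) :=
    integrableOn_exp_mul_complex_Ioi (by simpa using hε) 0
  rw [IntegrableOn, Measure.volume_eq_prod, ← Measure.prod_restrict]
  refine (h.mul_prod h).congr (.of_forall fun q => ?_)
  simp only [← Complex.exp_add]
  push_cast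
  ring_nf

lemma integrableOn_max_quadrant (t : ℝ) :
    IntegrableOn (fun q : ℝ × ℝ => ((max 0 (t - q.1 - q.2) : ℝ) : ℂ))
      (Set.Ioi (0:ℝ) ×ˢ Set.Ioi (0:ℝ)) := by
  have h : IntegrableOn (fun q : ℝ × ℝ => ((max 0 (t - q.1 - q.2) : ℝ) : ℂ))
      (Set.Icc 0 t ×ˢ Set.Icc 0 t) :=
    Continuous.continuousOn (by fun_prop) |>.integrableOn_compact (isCompact_Icc.prod isCompact_Icc)
  refine h.of_forall_sdiff_eq_zero (measurableSet_Ioi.prod measurableSet_Ioi) ?_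
  rintro ⟨s, r⟩ ⟨⟨hs, hr⟩, hn⟩
  simp only [Set.mem_Ioi, Set.mem_prod, Set.mem_Icc] at hs hr hn
  rw [max_eq_left, Complex.ofReal_zero]
  by_contra! h
  exact hn ⟨⟨hs.le, by linarith⟩, hr.le, by linarith⟩

/-- As tempered distributions in `(x,y)`, the iterated time integral
`(1/t)∫₀ᵗ∫₀^{t₁}∫₀^{t₂} e^{ixt₁}e^{iyt₂}e^{−i(x+y)t₃} dt₃ dt₂ dt₁` converges to
`−1/((x+i0)(x+y+i0))` as `t → +∞`. -/
theorem triple_time_integral_tendsto (φ : SchwartzMap (ℝ × ℝ) ℂ) :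
    ∃ L : ℂ,
      Tendsto (fun ε : ℝ => ∫ p : ℝ × ℝ,
          φ p / (((p.1 : ℂ) + Complex.I * (ε : ℂ)) *
            ((p.1 : ℂ) + (p.2 : ℂ) + Complex.I * (ε : ℂ))))
        (nhdsWithin 0 (Set.Ioi 0)) (nhds L) ∧
      Tendsto (fun t : ℝ =>
          (1 / (t : ℂ)) * ∫ p : ℝ × ℝ,
            (∫ t₁ in (0:ℝ)..t, ∫ t₂ in (0:ℝ)..t₁, ∫ t₃ in (0:ℝ)..t₂,
              Complex.exp (Complex.I * (p.1 : ℂ) * (t₁ : ℂ)) *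
                Complex.exp (Complex.I * (p.2 : ℂ) * (t₂ : ℂ)) *
                Complex.exp (-Complex.I * ((p.1 : ℂ) + (p.2 : ℂ)) * (t₃ : ℂ))) * φ p)
        atTop (nhds (-L)) := by
  obtain ⟨F, hF⟩ := exists_schwartzMap_eq_integral_exp_mul φ
  let Q : Set (ℝ × ℝ) := Set.Ioi 0 ×ˢ Set.Ioi 0
  have hQ : MeasurableSet Q := measurableSet_Ioi.prod measurableSet_Ioi
  have hFQ : IntegrableOn F Q := (F.integrable (μ := volume)).integrableOn
  refine ⟨-∫ q in Q, F q, ?_, ?_⟩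
  · have hlim : Tendsto (fun ε : ℝ => ∫ q in Q, Complex.exp (-(ε * (q.1 + q.2) : ℝ)) * F q)
        (nhdsWithin 0 (Set.Ioi 0)) (nhds (∫ q in Q, F q)) := by
      refine tendsto_integral_mul_of_norm_le_one hFQ
        (.of_forall fun ε => Continuous.aestronglyMeasurable (by fun_prop)) ?_
        (.of_forall fun q => ?_)
      · filter_upwards [self_mem_nhdsWithin] with ε hε
        filter_upwards [ae_restrict_mem hQ] with q hq
        rw [← Complex.ofReal_neg, Complex.norm_exp_ofReal, Real.exp_le_one_iff, neg_nonpos]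
        exact mul_nonneg hε.le (add_nonneg hq.1.le hq.2.le)
      · have : Continuous fun ε : ℝ => Complex.exp (-(ε * (q.1 + q.2) : ℝ)) := by fun_prop
        simpa using (this.tendsto 0).mono_left nhdsWithin_le_nhds
    refine hlim.neg.congr' ?_
    filter_upwards [self_mem_nhdsWithin] with ε hε
    rw [← integral_integral_mul_exp_mul φ F hF (integrableOn_exp_quadrant hε), ← integral_neg]
    congr 1 with p
    rw [integral_exp_quadrant hε]
    ring
  · rw [neg_neg]
    have hlim : Tendsto (fun t : ℝ => ∫ q in Q, (1 / (t : ℂ) * (max 0 (t - q.1 - q.2) : ℝ)) * F q)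
        atTop (nhds (∫ q in Q, F q)) := by
      refine tendsto_integral_mul_of_norm_le_one hFQ
        (.of_forall fun t => Continuous.aestronglyMeasurable (by fun_prop)) ?_
        (.of_forall fun q => ?_)
      · filter_upwards [eventually_gt_atTop 0] with t ht
        filter_upwards [ae_restrict_mem hQ] with q hq
        have h1 : 0 < q.1 := hq.1
        have h2 : 0 < q.2 := hq.2
        rw [norm_mul, norm_div, norm_one, Complex.norm_of_nonneg ht.le,
          Complex.norm_of_nonneg (le_max_left _ _), one_div, inv_mul_le_one₀ ht]
        exact max_le ht.le (by linarith)
      · have h : Tendsto (fun t : ℝ => ((1 - (q.1 + q.2) * t⁻¹ : ℝ) : ℂ)) atTop (nhds 1) := by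
          have : Tendsto (fun t : ℝ => 1 - (q.1 + q.2) * t⁻¹) atTop (nhds 1) := by
            simpa using (tendsto_inv_atTop_zero.const_mul (q.1 + q.2)).const_sub 1
          exact Complex.ofReal_one ▸ (Complex.continuous_ofReal.tendsto _).comp this
        refine h.congr' ?_
        filter_upwards [eventually_gt_atTop 0, eventually_gt_atTop (q.1 + q.2)] with t ht htq
        have : (t : ℂ) ≠ 0 := by exact_mod_cast ht.ne'
        rw [max_eq_right (by linarith)]
        push_cast
        field_simp
        ring
    refine hlim.congr' ?_
    filter_upwards [eventually_gt_atTop 0] with t ht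
    simp only [mul_assoc]
    rw [integral_const_mul, ← integral_integral_mul_exp_mul φ F hF (integrableOn_max_quadrant t)]
    congr 2 with p
    rw [← integral_simplex_eq_setIntegral_quadrant (g := fun q => Complex.exp (Complex.I *
      ((p.1 * q.1 + (p.1 + p.2) * q.2 : ℝ) : ℂ))) (by fun_prop) ht.le]
    congr 1
    refine intervalIntegral.integral_congr fun t₁ _ => intervalIntegral.integral_congr fun t₂ _ =>
      intervalIntegral.integral_congr fun t₃ _ => ?_
    simp only [← Complex.exp_add]
    push_cast
    ring_nf
end

section
/- For every complex-valued Schwartz function φ on ℝ², lim_{t→+∞} (1/t) ∫_{ℝ²} (∫₀ᵗ e^{ixt₁} dt₁) · (∫₀ᵗ ∫₀^{t₂} e^{iyt₂} e^{−i(x+y)t₃} dt₃ dt₂) · φ(x,y) dx dy = 2πi · lim_{ε→0⁺} ∫_ℝ φ(0,y)/(y+iε) dy, and both limits exist. In other words, as tempered distributions in (x,y), the product of time integrals divided by t converges to 2πi δ(x) · 1/(y+i0) as t → +∞. -/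
open MeasureTheory Filter

/-- Fubini on the triangle `0 ≤ b ≤ a ≤ t`. -/
lemma integral_triangle_swap {F : ℝ → ℝ → ℂ} (hF : Continuous (Function.uncurry F)) {t : ℝ}
    (ht : 0 ≤ t) :
    ∫ a in (0:ℝ)..t, ∫ b in (0:ℝ)..a, F a b = ∫ b in (0:ℝ)..t, ∫ a in b..t, F a b := by
  set T : Set (ℝ × ℝ) := {z | z.2 ≤ z.1} with hT
  have hTm : MeasurableSet T := measurableSet_le measurable_snd measurable_fst
  have hint : Integrable (T.indicator (Function.uncurry F))
      ((volume.restrict (Set.Ioc 0 t)).prod (volume.restrict (Set.Ioc 0 t))) := by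
    refine Integrable.indicator ?_ hTm
    rw [Measure.prod_restrict]
    exact (hF.continuousOn.integrableOn_compact (isCompact_Icc.prod isCompact_Icc)).mono_set
      (Set.prod_mono Set.Ioc_subset_Icc_self Set.Ioc_subset_Icc_self)
  have hswap := integral_integral_swap
    (f := fun a b => T.indicator (Function.uncurry F) (a, b)) hint
  rw [intervalIntegral.integral_of_le ht, intervalIntegral.integral_of_le ht]
  convert hswap using 1
  · refine setIntegral_congr_fun measurableSet_Ioc fun a ha => ?_
    rw [intervalIntegral.integral_of_le ha.1.le]
    have h1 : (fun b => T.indicator (Function.uncurry F) (a, b))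
        = (Set.Iic a).indicator (F a) := by
      ext b; simp [Set.indicator, hT, Function.uncurry]
    rw [h1, setIntegral_indicator measurableSet_Iic]
    congr 2
    ext b
    simp only [Set.mem_Ioc, Set.mem_inter_iff, Set.mem_Iic]
    have := ha.2
    grind
  · refine setIntegral_congr_fun measurableSet_Ioc fun b hb => ?_
    rw [intervalIntegral.integral_of_le hb.2, ← integral_Icc_eq_integral_Ioc]
    have h1 : (fun a => T.indicator (Function.uncurry F) (a, b))
        = (Set.Ici b).indicator (fun a => F a b) := by
      ext a; simp [Set.indicator, hT, Function.uncurry]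
    rw [h1, setIntegral_indicator measurableSet_Ici]
    congr 2
    ext a
    simp only [Set.mem_Ioc, Set.mem_inter_iff, Set.mem_Ici, Set.mem_Icc]
    have := hb.1
    grind

/-- The inverse Fourier transform on `ℝ × ℝ` with kernel `exp (i (x u + y s))`, unnormalised. -/
noncomputable def planeTransform (φ : ℝ × ℝ → ℂ) (q : ℝ × ℝ) : ℂ :=
  ∫ p : ℝ × ℝ, Complex.exp (Complex.I * p.1 * q.1) * Complex.exp (Complex.I * p.2 * q.2) * φ p

lemma integrable_planeTransform (φ : SchwartzMap (ℝ × ℝ) ℂ) :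
    Integrable (planeTransform φ) := by
  set f : SchwartzMap (WithLp 2 (ℝ × ℝ)) ℂ :=
    SchwartzMap.compCLMOfContinuousLinearEquiv ℂ (WithLp.prodContinuousLinearEquiv 2 ℝ ℝ ℝ) φ
    with hf
  have h1 : Integrable (FourierTransform.fourier f : SchwartzMap (WithLp 2 (ℝ × ℝ)) ℂ) :=
    SchwartzMap.integrable _
  have h2 := (WithLp.volume_preserving_toLp ℝ ℝ).integrable_comp_of_integrable h1
  have h3 := h2.comp_smul (R := -(2 * Real.pi)⁻¹) (by simp [Real.pi_ne_zero])
  refine h3.congr (Eventually.of_forall fun q => ?_)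
  simp only [Function.comp, SchwartzMap.fourier_coe, Real.fourier_eq', planeTransform]
  rw [← (WithLp.volume_preserving_toLp ℝ ℝ).integral_comp
    (MeasurableEquiv.toLp 2 (ℝ × ℝ)).measurableEmbedding]
  refine integral_congr_ae (Eventually.of_forall fun p => ?_)
  simp only [hf, SchwartzMap.compCLMOfContinuousLinearEquiv_apply, Function.comp, smul_eq_mul]
  rw [← Complex.exp_add]
  congr 2
  have hpi : (Real.pi : ℂ) ≠ 0 := by exact_mod_cast Real.pi_ne_zero
  simp [WithLp.prod_inner_apply]
  field_simp
  ring

lemma product_time_integral_eq {t : ℝ} (ht : 0 ≤ t) (x y : ℝ) :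
    (∫ t₁ in (0:ℝ)..t, Complex.exp (Complex.I * x * t₁)) *
      (∫ t₂ in (0:ℝ)..t, ∫ t₃ in (0:ℝ)..t₂,
        Complex.exp (Complex.I * y * t₂) * Complex.exp (-Complex.I * (x + y) * t₃)) =
    ∫ r in (0:ℝ)..t, (∫ u in (0:ℝ)..t, Complex.exp (Complex.I * x * ((u - r : ℝ) : ℂ))) *
      ∫ s in (0:ℝ)..(t - r), Complex.exp (Complex.I * y * s) := by
  rw [integral_triangle_swap (by fun_prop) ht, ← intervalIntegral.integral_const_mul]
  refine intervalIntegral.integral_congr fun r _ => ?_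
  have h := intervalIntegral.integral_comp_sub_right (a := r) (b := t)
    (fun s : ℝ => Complex.exp (Complex.I * y * s)) r
  rw [sub_self] at h
  rw [← h]
  have h1 : ∀ a : ℝ, Complex.exp (Complex.I * y * a) * Complex.exp (-Complex.I * (x + y) * r)
      = Complex.exp (-Complex.I * x * r) * Complex.exp (Complex.I * y * ((a - r : ℝ) : ℂ)) := by
    intro a
    rw [← Complex.exp_add, ← Complex.exp_add]
    congr 1
    push_cast
    ring
  have h2 : ∀ u : ℝ, Complex.exp (Complex.I * x * ((u - r : ℝ) : ℂ))
      = Complex.exp (-Complex.I * x * r) * Complex.exp (Complex.I * x * u) := by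
    intro u
    rw [← Complex.exp_add]
    congr 1
    push_cast
    ring
  simp only [h1, h2, intervalIntegral.integral_const_mul]
  ring

lemma norm_exp_I_mul_mul (x u : ℝ) : ‖Complex.exp (Complex.I * x * u)‖ = 1 := by
  rw [mul_assoc, mul_comm, ← Complex.ofReal_mul, Complex.norm_exp_ofReal_mul_I]

lemma setIntegral_planeTransform (φ : SchwartzMap (ℝ × ℝ) ℂ) {t r : ℝ} (ht : 0 ≤ t) (hr : r ≤ t) :
    ∫ q in Set.Ioc (-r) (t - r) ×ˢ Set.Ioc 0 (t - r), planeTransform φ q =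
    ∫ p : ℝ × ℝ, (∫ u in (0:ℝ)..t, Complex.exp (Complex.I * p.1 * ((u - r : ℝ) : ℂ))) *
      (∫ s in (0:ℝ)..(t - r), Complex.exp (Complex.I * p.2 * s)) * φ p := by
  have hfin : IsFiniteMeasure ((volume : Measure (ℝ × ℝ)).restrict
      (Set.Ioc (-r) (t - r) ×ˢ Set.Ioc 0 (t - r))) := by
    refine isFiniteMeasure_restrict.2 (ne_of_lt ?_)
    rw [Measure.volume_eq_prod, Measure.prod_prod]
    exact ENNReal.mul_lt_top measure_Ioc_lt_top measure_Ioc_lt_top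
  simp only [planeTransform]
  rw [integral_integral_swap]
  · refine integral_congr_ae (Eventually.of_forall fun p => ?_)
    simp only
    rw [integral_mul_const, Measure.volume_eq_prod,
      setIntegral_prod_mul (fun u : ℝ => Complex.exp (Complex.I * p.1 * u))
        (fun s : ℝ => Complex.exp (Complex.I * p.2 * s)),
      ← intervalIntegral.integral_of_le (by linarith), ← intervalIntegral.integral_of_le (by linarith),
      intervalIntegral.integral_comp_sub_right (fun u : ℝ => Complex.exp (Complex.I * p.1 * u)) r,
      zero_sub]
  · refine (φ.integrable.comp_snd _).mono ?_ (Eventually.of_forall fun z => ?_)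
    · have := φ.continuous
      exact Continuous.aestronglyMeasurable (by unfold Function.uncurry; fun_prop)
    · simp [Function.uncurry, norm_exp_I_mul_mul]

lemma integral_product_time_integral (φ : SchwartzMap (ℝ × ℝ) ℂ) {t : ℝ} (ht : 0 < t) :
    (1 / (t : ℂ)) * ∫ p : ℝ × ℝ,
      (∫ t₁ in (0:ℝ)..t, Complex.exp (Complex.I * (p.1 : ℂ) * (t₁ : ℂ))) *
      (∫ t₂ in (0:ℝ)..t, ∫ t₃ in (0:ℝ)..t₂,
        Complex.exp (Complex.I * (p.2 : ℂ) * (t₂ : ℂ)) *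
          Complex.exp (-Complex.I * ((p.1 : ℂ) + (p.2 : ℂ)) * (t₃ : ℂ))) * φ p =
    ∫ r in (0:ℝ)..1, ∫ q in Set.Ioc (-(t * r)) (t - t * r) ×ˢ Set.Ioc 0 (t - t * r),
      planeTransform φ q := by
  rw [intervalIntegral.integral_comp_mul_left
    (fun r => ∫ q in Set.Ioc (-r) (t - r) ×ˢ Set.Ioc 0 (t - r), planeTransform φ q) ht.ne',
    mul_zero, mul_one, Complex.real_smul, one_div, Complex.ofReal_inv]
  congr 1
  have hc1 : Continuous fun z : (ℝ × ℝ) × ℝ =>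
      ∫ u in (0:ℝ)..t, Complex.exp (Complex.I * z.1.1 * ((u - z.2 : ℝ) : ℂ)) :=
    intervalIntegral.continuous_parametric_intervalIntegral_of_continuous
      (f := fun (z : (ℝ × ℝ) × ℝ) u => Complex.exp (Complex.I * z.1.1 * ((u - z.2 : ℝ) : ℂ)))
      (by unfold Function.uncurry; fun_prop) continuous_const
  have hc2 : Continuous fun z : (ℝ × ℝ) × ℝ =>
      ∫ s in (0:ℝ)..(t - z.2), Complex.exp (Complex.I * z.1.2 * s) :=
    intervalIntegral.continuous_parametric_intervalIntegral_of_continuous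
      (f := fun (z : (ℝ × ℝ) × ℝ) (s : ℝ) => Complex.exp (Complex.I * z.1.2 * s))
      (by unfold Function.uncurry; fun_prop) (by fun_prop)
  have hφ := φ.continuous
  have hint : Integrable (Function.uncurry fun (p : ℝ × ℝ) (r : ℝ) =>
      (∫ u in (0:ℝ)..t, Complex.exp (Complex.I * p.1 * ((u - r : ℝ) : ℂ))) *
        (∫ s in (0:ℝ)..(t - r), Complex.exp (Complex.I * p.2 * s)) * φ p)
      ((volume : Measure (ℝ × ℝ)).prod (volume.restrict (Set.Ioc 0 t))) := by
    refine ((φ.integrable.comp_fst _).const_mul ((t * t : ℝ) : ℂ)).mono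
      (Continuous.aestronglyMeasurable ?_) ?_
    · exact (hc1.mul hc2).mul (hφ.comp continuous_fst)
    · have hmem : ∀ᵐ z : (ℝ × ℝ) × ℝ ∂((volume : Measure (ℝ × ℝ)).prod
          (volume.restrict (Set.Ioc 0 t))), z.2 ∈ Set.Ioc 0 t :=
        Measure.quasiMeasurePreserving_snd.ae (ae_restrict_mem measurableSet_Ioc)
      filter_upwards [hmem] with z hz
      simp only [Function.uncurry, norm_mul, Complex.norm_real]
      have b1 := intervalIntegral.norm_integral_le_of_norm_le_const (a := 0) (b := t) (C := 1)
        (f := fun u : ℝ => Complex.exp (Complex.I * z.1.1 * ((u - z.2 : ℝ) : ℂ)))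
        fun u _ => (norm_exp_I_mul_mul _ _).le
      have b2 := intervalIntegral.norm_integral_le_of_norm_le_const (a := 0) (b := t - z.2) (C := 1)
        (f := fun s : ℝ => Complex.exp (Complex.I * z.1.2 * s))
        fun u _ => (norm_exp_I_mul_mul _ _).le
      rw [sub_zero, one_mul, abs_of_pos ht] at b1
      rw [sub_zero, one_mul, abs_of_nonneg (by linarith [hz.2])] at b2
      rw [Real.norm_of_nonneg ht.le]
      gcongr
      exact b2.trans (by linarith [hz.1])
  calc _ = ∫ p : ℝ × ℝ, ∫ r in Set.Ioc 0 t,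
        (∫ u in (0:ℝ)..t, Complex.exp (Complex.I * p.1 * ((u - r : ℝ) : ℂ))) *
        (∫ s in (0:ℝ)..(t - r), Complex.exp (Complex.I * p.2 * s)) * φ p := by
        refine integral_congr_ae (Eventually.of_forall fun p => ?_)
        simp only
        rw [product_time_integral_eq ht.le, intervalIntegral.integral_of_le ht.le,
          ← integral_mul_const]
    _ = ∫ r in Set.Ioc 0 t, ∫ p : ℝ × ℝ,
        (∫ u in (0:ℝ)..t, Complex.exp (Complex.I * p.1 * ((u - r : ℝ) : ℂ))) *
        (∫ s in (0:ℝ)..(t - r), Complex.exp (Complex.I * p.2 * s)) * φ p :=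
      integral_integral_swap hint
    _ = _ := by
      rw [intervalIntegral.integral_of_le ht.le]
      exact setIntegral_congr_fun measurableSet_Ioc
        fun r hr => (setIntegral_planeTransform φ ht.le hr.2).symm

lemma tendsto_integral_rectangles {f : ℝ × ℝ → ℂ} (hf : Integrable f) :
    Tendsto (fun t : ℝ => ∫ r in (0:ℝ)..1,
        ∫ q in Set.Ioc (-(t * r)) (t - t * r) ×ˢ Set.Ioc 0 (t - t * r), f q)
      atTop (nhds (∫ q in Set.univ ×ˢ Set.Ioi 0, f q)) := by
  have hm : ∀ t r : ℝ, MeasurableSet (Set.Ioc (-(t * r)) (t - t * r) ×ˢ Set.Ioc 0 (t - t * r)) :=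
    fun t r => measurableSet_Ioc.prod measurableSet_Ioc
  have hconst : ∫ q in Set.univ ×ˢ Set.Ioi 0, f q
      = ∫ _r in (0:ℝ)..1, ∫ q in Set.univ ×ˢ Set.Ioi 0, f q := by simp
  rw [hconst]
  refine intervalIntegral.tendsto_integral_filter_of_dominated_convergence
    (fun _ => ∫ q, ‖f q‖) (Eventually.of_forall fun t => ?_)
    (Eventually.of_forall fun t => Eventually.of_forall fun r _ => ?_)
    (by simp) ?_
  · have hset : MeasurableSet {z : ℝ × ℝ × ℝ |
        z.2 ∈ Set.Ioc (-(t * z.1)) (t - t * z.1) ×ˢ Set.Ioc 0 (t - t * z.1)} := by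
      have hl : Measurable fun z : ℝ × ℝ × ℝ => -(t * z.1) := by fun_prop
      have hu : Measurable fun z : ℝ × ℝ × ℝ => t - t * z.1 := by fun_prop
      have hx : Measurable fun z : ℝ × ℝ × ℝ => z.2.1 := by fun_prop
      have hy : Measurable fun z : ℝ × ℝ × ℝ => z.2.2 := by fun_prop
      exact ((measurableSet_lt hl hx).inter (measurableSet_le hx hu)).inter
        ((measurableSet_lt measurable_const hy).inter (measurableSet_le hy hu))
    have h := ((hf.aestronglyMeasurable.comp_snd
      (μ := (volume.restrict (Set.uIoc 0 1) : Measure ℝ))).indicator hset).integral_prod_right'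
    refine h.congr (Eventually.of_forall fun r => ?_)
    simp only
    rw [← integral_indicator (hm t r)]
    rfl
  · exact (norm_integral_le_integral_norm _).trans
      (setIntegral_le_integral hf.norm (Eventually.of_forall fun q => norm_nonneg _))
  · have hne : ∀ᵐ r : ℝ, r ≠ 1 := by simp [ae_iff]
    filter_upwards [hne] with r hr1 hr
    rw [Set.uIoc_of_le zero_le_one] at hr
    have hr0 : 0 < r := hr.1
    have hr' : 0 < 1 - r := sub_pos.2 (lt_of_le_of_ne hr.2 hr1)
    simp only [← integral_indicator (hm _ _)]
    rw [← integral_indicator (MeasurableSet.univ.prod measurableSet_Ioi)]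
    refine tendsto_integral_filter_of_dominated_convergence (fun q => ‖f q‖)
      (Eventually.of_forall fun t => hf.aestronglyMeasurable.indicator (hm _ _))
      (Eventually.of_forall fun t => Eventually.of_forall fun q => norm_indicator_le_norm_self _ _)
      hf.norm (Eventually.of_forall fun q => ?_)
    have e1 : Tendsto (fun t : ℝ => t * r) atTop atTop := tendsto_id.atTop_mul_const hr0
    have e2 : Tendsto (fun t : ℝ => t - t * r) atTop atTop := by
      have := (tendsto_id (α := ℝ) (x := atTop)).atTop_mul_const hr'
      refine this.congr fun t => ?_
      simp only [id]
      ring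
    refine tendsto_const_nhds.congr' ?_
    filter_upwards [e1.eventually_gt_atTop (-q.1), e2.eventually_ge_atTop q.1,
      e2.eventually_ge_atTop q.2] with t h1 h2 h3
    have : q ∈ Set.Ioc (-(t * r)) (t - t * r) ×ˢ Set.Ioc 0 (t - t * r)
        ↔ q ∈ (Set.univ : Set ℝ) ×ˢ Set.Ioi (0:ℝ) := by
      simp only [Set.mem_prod, Set.mem_Ioc, Set.mem_univ, Set.mem_Ioi, true_and]
      constructor
      · exact fun h => h.2.1
      · exact fun h => ⟨⟨by linarith, h2⟩, h, h3⟩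
    by_cases hq : q ∈ (Set.univ : Set ℝ) ×ˢ Set.Ioi (0:ℝ)
    · rw [Set.indicator_of_mem hq, Set.indicator_of_mem (this.2 hq)]
    · rw [Set.indicator_of_notMem hq, Set.indicator_of_notMem (mt this.1 hq)]

lemma SchwartzMap.exists_norm_le_mul_inv_one_add_sq (φ : SchwartzMap (ℝ × ℝ) ℂ) :
    ∃ C : ℝ, ∀ x y : ℝ, ‖φ (x, y)‖ ≤ C * (1 + y ^ 2)⁻¹ := by
  obtain ⟨C₀, -, h₀⟩ := φ.decay 0 0
  obtain ⟨C₂, -, h₂⟩ := φ.decay 2 0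
  refine ⟨C₀ + C₂, fun x y => ?_⟩
  have h₀ := h₀ (x, y)
  have h₂ := h₂ (x, y)
  simp only [norm_iteratedFDeriv_zero, pow_zero, one_mul] at h₀ h₂
  rw [← div_eq_mul_inv, le_div_iff₀ (by positivity)]
  have hy : y ^ 2 ≤ ‖(x, y)‖ ^ 2 := by
    rw [← sq_abs y, ← Real.norm_eq_abs]
    gcongr
    exact norm_snd_le (x, y)
  nlinarith [mul_le_mul_of_nonneg_right hy (norm_nonneg (φ (x, y)))]

lemma SchwartzMap.integrable_slice (φ : SchwartzMap (ℝ × ℝ) ℂ) (x : ℝ) :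
    Integrable fun y : ℝ => φ (x, y) := by
  obtain ⟨C, hC⟩ := φ.exists_norm_le_mul_inv_one_add_sq
  have := φ.continuous
  exact (integrable_inv_one_add_sq.const_mul C).mono'
    (Continuous.aestronglyMeasurable (by fun_prop)) (Eventually.of_forall fun y => hC x y)

/-- Integrating out the first frequency variable restricts to the line `x = 0`. -/
lemma integral_planeTransform_fst (φ : SchwartzMap (ℝ × ℝ) ℂ) :
    ∀ᵐ s : ℝ, ∫ u : ℝ, planeTransform φ (u, s) =
      2 * Real.pi * ∫ y : ℝ, Complex.exp (Complex.I * y * s) * φ (0, y) := by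
  have hφ := φ.continuous
  have hint := integrable_planeTransform φ
  rw [Measure.volume_eq_prod] at hint
  filter_upwards [hint.prod_left_ae] with s hs
  have hkernel : Integrable (fun p : ℝ × ℝ => Complex.exp (Complex.I * p.2 * s) * φ p)
      (volume.prod volume) := by
    rw [← Measure.volume_eq_prod]
    refine φ.integrable.mono (Continuous.aestronglyMeasurable (by fun_prop))
      (Eventually.of_forall fun p => ?_)
    simp [norm_exp_I_mul_mul]
  set g : ℝ → ℂ := fun x => ∫ y : ℝ, Complex.exp (Complex.I * y * s) * φ (x, y) with hg
  have hgi : Integrable g := hkernel.integral_prod_left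
  have hgc : Continuous g := by
    obtain ⟨C, hC⟩ := φ.exists_norm_le_mul_inv_one_add_sq
    refine continuous_of_dominated (bound := fun y => C * (1 + y ^ 2)⁻¹)
      (fun x => Continuous.aestronglyMeasurable (by fun_prop))
      (fun x => Eventually.of_forall fun y => ?_) (integrable_inv_one_add_sq.const_mul C)
      (Eventually.of_forall fun y => by fun_prop)
    rw [norm_mul, norm_exp_I_mul_mul, one_mul]
    exact hC x y
  have hF : FourierTransform.fourier g = fun w => planeTransform φ (-(2 * Real.pi) * w, s) := by
    ext w
    rw [Real.fourier_real_eq_integral_exp_smul, planeTransform, Measure.volume_eq_prod,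
      integral_prod]
    · refine integral_congr_ae (Eventually.of_forall fun x => ?_)
      simp only [hg, smul_eq_mul]
      rw [← integral_const_mul]
      refine integral_congr_ae (Eventually.of_forall fun y => ?_)
      simp only
      rw [← mul_assoc]
      congr 3
      push_cast
      ring
    · rw [← Measure.volume_eq_prod]
      refine φ.integrable.mono (Continuous.aestronglyMeasurable (by fun_prop))
        (Eventually.of_forall fun p => ?_)
      simp only [norm_mul, norm_exp_I_mul_mul, one_mul, le_refl]
  have hFi : Integrable (FourierTransform.fourier g) := by
    rw [hF]
    exact hs.comp_mul_left' (R := -(2 * Real.pi)) (by simp [Real.pi_ne_zero])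
  have hinv := hgi.fourierInv_fourier_eq hFi (v := 0) hgc.continuousAt
  rw [Real.fourierInv_eq', hF] at hinv
  simp only [inner_zero_right, mul_zero, Complex.ofReal_zero, zero_mul, Complex.exp_zero,
    one_smul] at hinv
  rw [Measure.integral_comp_mul_left (fun u => planeTransform φ (u, s))] at hinv
  have habs : |(-(2 * Real.pi))⁻¹| = (2 * Real.pi)⁻¹ := by
    rw [abs_inv, abs_neg, abs_of_pos Real.two_pi_pos]
  rw [habs, Complex.real_smul] at hinv
  change _ = 2 * Real.pi * g 0
  rw [← hinv]
  have hpi : (Real.pi : ℂ) ≠ 0 := by exact_mod_cast Real.pi_ne_zero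
  push_cast
  field_simp

lemma inv_add_I_mul_eq_integral (y : ℝ) {ε : ℝ} (hε : 0 < ε) :
    ((y : ℂ) + Complex.I * ε)⁻¹ =
      -Complex.I * ∫ s in Set.Ioi (0:ℝ), Complex.exp ((Complex.I * y - ε) * s) := by
  have hre : (Complex.I * y - ε).re < 0 := by simp [hε]
  rw [integral_exp_mul_complex_Ioi hre]
  have h1 : (Complex.I * y - ε) ≠ 0 := fun h => by simp [h] at hre
  have h2 : (y : ℂ) + Complex.I * ε = -Complex.I * (Complex.I * y - ε) := by
    linear_combination (y : ℂ) * Complex.I_sq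
  rw [h2]
  have := Complex.I_ne_zero
  simp only [Complex.ofReal_zero, mul_zero, Complex.exp_zero]
  field_simp
  simp

/-- The boundary value `1 / (y + i0)` expressed through the one-sided Fourier transform. -/
lemma tendsto_integral_div_add_I_mul {f : ℝ → ℂ} (hf : Integrable f)
    (hF : IntegrableOn (fun s : ℝ => ∫ y : ℝ, Complex.exp (Complex.I * y * s) * f y)
      (Set.Ioi 0)) :
    Tendsto (fun ε : ℝ => ∫ y : ℝ, f y / ((y : ℂ) + Complex.I * (ε : ℂ)))
      (nhdsWithin 0 (Set.Ioi 0)) (nhds (-Complex.I *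
        ∫ s in Set.Ioi (0:ℝ), ∫ y : ℝ, Complex.exp (Complex.I * y * s) * f y)) := by
  have key : ∀ ε : ℝ, 0 < ε → ∫ y : ℝ, f y / ((y : ℂ) + Complex.I * (ε : ℂ)) =
      -Complex.I * ∫ s in Set.Ioi (0:ℝ), Complex.exp (-(ε * s : ℝ)) *
        ∫ y : ℝ, Complex.exp (Complex.I * y * s) * f y := by
    intro ε hε
    simp only [div_eq_mul_inv, inv_add_I_mul_eq_integral _ hε, ← integral_const_mul]
    rw [integral_integral_swap]
    · refine setIntegral_congr_fun measurableSet_Ioi fun s _ => ?_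
      refine integral_congr_ae (Eventually.of_forall fun y => ?_)
      simp only
      rw [show (Complex.I * y - ε) * s = -((ε * s : ℝ) : ℂ) + Complex.I * y * s by
        push_cast; ring, Complex.exp_add]
      ring
    · have hexp : Integrable (fun s : ℝ => Real.exp (-ε * s)) (volume.restrict (Set.Ioi 0)) :=
        exp_neg_integrableOn_Ioi 0 hε
      refine (hf.norm.mul_prod hexp).mono ?_ (Eventually.of_forall fun z => ?_)
      · refine hf.aestronglyMeasurable.comp_fst.mul (Continuous.aestronglyMeasurable ?_)
        fun_prop
      · simp [Function.uncurry, Complex.norm_exp]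
  refine (Tendsto.const_mul (-Complex.I) ?_).congr' (f₁ := fun ε : ℝ =>
    -Complex.I * ∫ s in Set.Ioi (0:ℝ), Complex.exp (-(ε * s : ℝ)) *
      ∫ y : ℝ, Complex.exp (Complex.I * y * s) * f y)
    (eventually_nhdsWithin_of_forall fun ε hε => (key ε hε).symm)
  refine tendsto_integral_filter_of_dominated_convergence _
    (Eventually.of_forall fun ε => ?_) ?_ hF.norm (Eventually.of_forall fun s => ?_)
  · exact (Continuous.aestronglyMeasurable (by fun_prop)).mul hF.aestronglyMeasurable
  · refine eventually_nhdsWithin_of_forall fun ε hε => ?_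
    filter_upwards [ae_restrict_mem measurableSet_Ioi] with s hs
    rw [norm_mul]
    refine mul_le_of_le_one_left (norm_nonneg _) ?_
    have : 0 < ε * s := mul_pos hε hs
    rw [Complex.norm_exp]
    simpa using this.le
  · have hc : Continuous fun ε : ℝ => Complex.exp (-(ε * s : ℝ)) *
        ∫ y : ℝ, Complex.exp (Complex.I * y * s) * f y := by fun_prop
    have := (hc.tendsto 0).mono_left (nhdsWithin_le_nhds (s := Set.Ioi 0))
    simpa using this

/-- As tempered distributions in `(x,y)`, the product of time integrals
`(1/t)(∫₀ᵗ e^{ixt₁} dt₁)(∫₀ᵗ∫₀^{t₂} e^{iyt₂}e^{−i(x+y)t₃} dt₃ dt₂)` converges to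
`2πi δ(x) · 1/(y+i0)` as `t → +∞`. -/
theorem product_time_integral_tendsto (φ : SchwartzMap (ℝ × ℝ) ℂ) :
    ∃ L : ℂ,
      Tendsto (fun ε : ℝ => ∫ y : ℝ, φ (0, y) / ((y : ℂ) + Complex.I * (ε : ℂ)))
        (nhdsWithin 0 (Set.Ioi 0)) (nhds L) ∧
      Tendsto (fun t : ℝ =>
          (1 / (t : ℂ)) * ∫ p : ℝ × ℝ,
            (∫ t₁ in (0:ℝ)..t, Complex.exp (Complex.I * (p.1 : ℂ) * (t₁ : ℂ))) *
            (∫ t₂ in (0:ℝ)..t, ∫ t₃ in (0:ℝ)..t₂,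
              Complex.exp (Complex.I * (p.2 : ℂ) * (t₂ : ℂ)) *
                Complex.exp (-Complex.I * ((p.1 : ℂ) + (p.2 : ℂ)) * (t₃ : ℂ))) * φ p)
        atTop (nhds (2 * (Real.pi : ℂ) * Complex.I * L)) := by
  set h : ℝ → ℂ := fun s => ∫ y : ℝ, Complex.exp (Complex.I * y * s) * φ (0, y) with hh
  have hΨ := integrable_planeTransform φ
  have hpi : (2 * Real.pi : ℂ) ≠ 0 := by exact_mod_cast Real.two_pi_pos.ne'
  have hint : Integrable h := by
    have h1 := hΨ
    rw [Measure.volume_eq_prod] at h1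
    refine (h1.integral_prod_right.const_mul (2 * Real.pi : ℂ)⁻¹).congr ?_
    filter_upwards [integral_planeTransform_fst φ] with s hs
    rw [hs, inv_mul_cancel_left₀ hpi]
  refine ⟨-Complex.I * ∫ s in Set.Ioi (0:ℝ), h s,
    tendsto_integral_div_add_I_mul (φ.integrable_slice 0) hint.integrableOn, ?_⟩
  have hlim : ∫ q in Set.univ ×ˢ Set.Ioi 0, planeTransform φ q =
      2 * Real.pi * Complex.I * (-Complex.I * ∫ s in Set.Ioi (0:ℝ), h s) := by
    rw [Measure.volume_eq_prod] at hΨ ⊢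
    have hr := hΨ.restrict (s := Set.univ ×ˢ Set.Ioi (0:ℝ))
    rw [← Measure.prod_restrict, Measure.restrict_univ] at hr ⊢
    rw [integral_prod_symm _ hr,
      integral_congr_ae (ae_restrict_of_ae (integral_planeTransform_fst φ)), integral_const_mul]
    linear_combination (2 * Real.pi * ∫ s in Set.Ioi (0:ℝ), h s) * Complex.I_sq
  rw [← hlim]
  refine (tendsto_integral_rectangles hΨ).congr' ?_
  filter_upwards [eventually_gt_atTop 0] with t ht
  exact (integral_product_time_integral φ ht).symm
end

section
/- Fix a sign s ∈ {+1, −1}. For all complex-valued Schwartz functions ρ and φ on ℝ, lim_{l→+∞} lim_{ε→0⁺} ∫_ℝ (ρ(lx)/(x + s·iε)) φ(x) dx = (lim_{ε→0⁺} ∫_ℝ ρ(v)/(v + s·iε) dv) · φ(0), all the indicated limits existing. In other words, as tempered distributions, ρ(lx)/(x ± i0) converges to (∫_ℝ ρ(v)/(v ± i0) dv) δ(x) as l → +∞. -/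
open MeasureTheory Filter

lemma abs_le_norm_add_mul_I_mul (s v ε : ℝ) :
    |v| ≤ ‖(v : ℂ) + (s : ℂ) * Complex.I * (ε : ℂ)‖ := by
  have h := Complex.abs_re_le_norm ((v : ℂ) + (s : ℂ) * Complex.I * (ε : ℂ))
  simpa using h

lemma le_norm_add_mul_I_mul {s : ℝ} (hs : s = 1 ∨ s = -1) (v ε : ℝ) :
    ε ≤ ‖(v : ℂ) + (s : ℂ) * Complex.I * (ε : ℂ)‖ := by
  have h := Complex.abs_im_le_norm ((v : ℂ) + (s : ℂ) * Complex.I * (ε : ℂ))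
  refine (le_abs_self ε).trans ?_
  rcases hs with rfl | rfl <;> simpa using h

lemma add_mul_I_mul_ne_zero {s : ℝ} (hs : s = 1 ∨ s = -1) (v : ℝ) {ε : ℝ} (hε : 0 < ε) :
    (v : ℂ) + (s : ℂ) * Complex.I * (ε : ℂ) ≠ 0 :=
  norm_pos_iff.1 (hε.trans_le (le_norm_add_mul_I_mul hs v ε))

lemma MeasureTheory.Integrable.div_add_mul_I_mul {s : ℝ} (hs : s = 1 ∨ s = -1) {ψ : ℝ → ℂ}
    (hψ : Integrable ψ) {ε : ℝ} (hε : 0 < ε) :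
    Integrable (fun v : ℝ => ψ v / ((v : ℂ) + (s : ℂ) * Complex.I * (ε : ℂ))) := by
  simp only [div_eq_mul_inv]
  refine hψ.mul_bdd (c := ε⁻¹) ?_ ?_
  · refine Continuous.aestronglyMeasurable ?_
    exact Continuous.inv₀ (by fun_prop) fun v => add_mul_I_mul_ne_zero hs v hε
  · refine ae_of_all _ fun v => ?_
    rw [norm_inv]
    exact inv_anti₀ hε (le_norm_add_mul_I_mul hs v ε)

lemma integral_inv_add_mul_I_mul {s : ℝ} (hs : s = 1 ∨ s = -1) {ε : ℝ} (hε : 0 < ε) :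
    ∫ v in (-1 : ℝ)..1, ((v : ℂ) + (s : ℂ) * Complex.I * (ε : ℂ))⁻¹ =
      Complex.log (1 + (s : ℂ) * Complex.I * (ε : ℂ)) -
        Complex.log (-1 + (s : ℂ) * Complex.I * (ε : ℂ)) := by
  have h := intervalIntegral.integral_eq_sub_of_hasDerivAt (a := -1) (b := 1)
    (f := fun v : ℝ => Complex.log ((v : ℂ) + (s : ℂ) * Complex.I * (ε : ℂ)))
    (f' := fun v : ℝ => ((v : ℂ) + (s : ℂ) * Complex.I * (ε : ℂ))⁻¹) ?_ ?_
  · simpa using h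
  · intro v _
    have hslit : (v : ℂ) + (s : ℂ) * Complex.I * (ε : ℂ) ∈ Complex.slitPlane := by
      refine Or.inr ?_
      rcases hs with rfl | rfl <;> simp [hε.ne']
    have h1 : HasDerivAt (fun v : ℝ => (v : ℂ) + (s : ℂ) * Complex.I * (ε : ℂ)) 1 v :=
      (Complex.ofRealCLM.hasDerivAt (x := v)).add_const _
    simpa using h1.clog_real hslit
  · refine Continuous.intervalIntegrable ?_ _ _
    exact Continuous.inv₀ (by fun_prop) fun v => add_mul_I_mul_ne_zero hs v hε

lemma exists_tendsto_integral_inv_add_mul_I_mul {s : ℝ} (hs : s = 1 ∨ s = -1) :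
    ∃ A : ℂ, Tendsto
      (fun ε : ℝ => ∫ v in (-1 : ℝ)..1, ((v : ℂ) + (s : ℂ) * Complex.I * (ε : ℂ))⁻¹)
      (nhdsWithin 0 (Set.Ioi 0)) (nhds A) := by
  have hlim (c : ℂ) : Tendsto (fun ε : ℝ => c + (s : ℂ) * Complex.I * (ε : ℂ))
      (nhdsWithin 0 (Set.Ioi 0)) (nhds c) := by
    have h : Continuous fun ε : ℝ => c + (s : ℂ) * Complex.I * (ε : ℂ) := by fun_prop
    simpa using (h.tendsto 0).mono_left nhdsWithin_le_nhds
  have hone := (hlim 1).clog (by simp)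
  obtain ⟨B, hB⟩ : ∃ B : ℂ, Tendsto
      (fun ε : ℝ => Complex.log (-1 + (s : ℂ) * Complex.I * (ε : ℂ)))
      (nhdsWithin 0 (Set.Ioi 0)) (nhds B) := by
    rcases hs with rfl | rfl
    · refine ⟨_, (Complex.tendsto_log_nhdsWithin_im_nonneg_of_re_neg_of_im_zero
        (z := -1) (by simp) (by simp)).comp
        (tendsto_nhdsWithin_iff.2 ⟨hlim (-1), ?_⟩)⟩
      filter_upwards [self_mem_nhdsWithin] with ε hε
      simpa using (Set.mem_Ioi.1 hε).le
    · refine ⟨_, (Complex.tendsto_log_nhdsWithin_im_neg_of_re_neg_of_im_zero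
        (z := -1) (by simp) (by simp)).comp
        (tendsto_nhdsWithin_iff.2 ⟨hlim (-1), ?_⟩)⟩
      filter_upwards [self_mem_nhdsWithin] with ε hε
      simpa using hε
  refine ⟨_, (hone.sub hB).congr' ?_⟩
  filter_upwards [self_mem_nhdsWithin] with ε hε
  exact (integral_inv_add_mul_I_mul hs hε).symm

/-- The distribution `1/(x ± i0)` is defined on every integrable function which is Lipschitz
at the origin. -/
lemma exists_tendsto_integral_div_add_mul_I_mul {s : ℝ} (hs : s = 1 ∨ s = -1) {ψ : ℝ → ℂ}
    (hψ : Integrable ψ) {M : ℝ} (hM : ∀ v, ‖ψ v - ψ 0‖ ≤ M * |v|) :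
    ∃ A : ℂ, Tendsto (fun ε : ℝ => ∫ v : ℝ, ψ v / ((v : ℂ) + (s : ℂ) * Complex.I * (ε : ℂ)))
      (nhdsWithin 0 (Set.Ioi 0)) (nhds A) := by
  obtain ⟨A, hA⟩ := exists_tendsto_integral_inv_add_mul_I_mul hs
  have hM0 : 0 ≤ M := by simpa using (norm_nonneg _).trans (hM 1)
  let χ : ℝ → ℂ := (Set.Ioc (-1 : ℝ) 1).indicator fun _ => ψ 0
  have hχ : Integrable χ :=
    (integrable_indicator_iff measurableSet_Ioc).2 (integrableOn_const (by simp))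
  have hsub : Integrable fun v => ψ v - χ v := hψ.sub hχ
  have hχ_int (ε : ℝ) : ∫ v : ℝ, χ v / ((v : ℂ) + (s : ℂ) * Complex.I * (ε : ℂ)) =
      ψ 0 * ∫ v in (-1 : ℝ)..1, ((v : ℂ) + (s : ℂ) * Complex.I * (ε : ℂ))⁻¹ := by
    rw [intervalIntegral.integral_of_le (by norm_num), ← integral_const_mul,
      ← integral_indicator measurableSet_Ioc]
    congr 1 with v
    by_cases hv : v ∈ Set.Ioc (-1 : ℝ) 1 <;> simp [χ, hv, div_eq_mul_inv]
  have hdct : Tendsto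
      (fun ε : ℝ => ∫ v : ℝ, (ψ v - χ v) / ((v : ℂ) + (s : ℂ) * Complex.I * (ε : ℂ)))
      (nhdsWithin 0 (Set.Ioi 0)) (nhds (∫ v : ℝ, (ψ v - χ v) / (v : ℂ))) := by
    refine tendsto_integral_filter_of_dominated_convergence
      (fun v => (Set.Ioc (-1 : ℝ) 1).indicator (fun _ => M) v + ‖ψ v‖) ?_ ?_ ?_ ?_
    · filter_upwards [self_mem_nhdsWithin] with ε hε
      exact (hsub.div_add_mul_I_mul hs hε).aestronglyMeasurable
    · filter_upwards [self_mem_nhdsWithin] with ε hε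
      refine ae_of_all _ fun v => ?_
      have hK := abs_le_norm_add_mul_I_mul s v ε
      have hpos := norm_pos_iff.2 (add_mul_I_mul_ne_zero hs v hε)
      rw [norm_div, div_le_iff₀ hpos]
      by_cases hv : v ∈ Set.Ioc (-1 : ℝ) 1
      · simp only [χ, Set.indicator_of_mem hv]
        calc ‖ψ v - ψ 0‖ ≤ M * |v| := hM v
          _ ≤ (M + ‖ψ v‖) * ‖(v : ℂ) + (s : ℂ) * Complex.I * (ε : ℂ)‖ := by
            gcongr
            exact le_add_of_nonneg_right (norm_nonneg _)
      · simp only [χ, Set.indicator_of_notMem hv, sub_zero, zero_add]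
        refine le_mul_of_one_le_right (norm_nonneg _) (le_trans ?_ hK)
        by_contra! h
        exact hv ⟨(abs_lt.1 h).1, (abs_lt.1 h).2.le⟩
    · exact ((integrable_indicator_iff measurableSet_Ioc).2
        (integrableOn_const (by simp))).add hψ.norm
    · filter_upwards [Measure.ae_ne volume (0 : ℝ)] with v hv
      refine Tendsto.div tendsto_const_nhds ?_ (by exact_mod_cast hv)
      have h : Continuous fun ε : ℝ => (v : ℂ) + (s : ℂ) * Complex.I * (ε : ℂ) := by fun_prop
      simpa using (h.tendsto 0).mono_left nhdsWithin_le_nhds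
  refine ⟨_, (hdct.add (hA.const_mul (ψ 0))).congr' ?_⟩
  filter_upwards [self_mem_nhdsWithin] with ε hε
  rw [← hχ_int, ← integral_add (hsub.div_add_mul_I_mul hs hε)
    (hχ.div_add_mul_I_mul hs hε)]
  congr 1 with v
  ring

lemma SchwartzMap.exists_norm_sub_apply_zero_le (f : SchwartzMap ℝ ℂ) :
    ∃ M : ℝ, 0 ≤ M ∧ ∀ v, ‖f v - f 0‖ ≤ M * |v| := by
  obtain ⟨M, hM⟩ := f.decay 0 1
  refine ⟨M, hM.1.le, fun v => ?_⟩
  have h := Convex.norm_image_sub_le_of_norm_deriv_le (f := f) (s := Set.univ) (C := M)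
    (x := 0) (y := v) (fun x _ => f.differentiableAt) ?_ convex_univ trivial trivial
  · simpa using h
  · intro x _
    simpa [norm_iteratedFDeriv_eq_norm_iteratedDeriv] using hM.2 x

lemma SchwartzMap.exists_norm_le (f : SchwartzMap ℝ ℂ) : ∃ M : ℝ, 0 ≤ M ∧ ∀ v, ‖f v‖ ≤ M := by
  obtain ⟨M, hM⟩ := f.decay 0 0
  exact ⟨M, hM.1.le, fun v => by simpa using hM.2 v⟩

lemma integral_comp_mul_left_div_add_mul_I_mul (s : ℝ) (ψ : ℝ → ℂ) {l : ℝ} (hl : 0 < l)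
    (ε : ℝ) :
    ∫ x : ℝ, ψ (l * x) / ((x : ℂ) + (s : ℂ) * Complex.I * (ε : ℂ)) =
      ∫ v : ℝ, ψ v / ((v : ℂ) + (s : ℂ) * Complex.I * ((l * ε : ℝ) : ℂ)) := by
  have h := Measure.integral_comp_mul_left
    (fun v : ℝ => ψ v / ((v : ℂ) + (s : ℂ) * Complex.I * ((l * ε : ℝ) : ℂ))) l
  have hl' : (l : ℂ) ≠ 0 := by exact_mod_cast hl.ne'
  rw [abs_of_pos (inv_pos.2 hl), eq_inv_smul_iff₀ hl.ne', ← integral_smul] at h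
  rw [← h]
  congr 1 with x
  have hden : ((l * x : ℝ) : ℂ) + (s : ℂ) * Complex.I * ((l * ε : ℝ) : ℂ) =
      l * ((x : ℂ) + (s : ℂ) * Complex.I * (ε : ℂ)) := by
    push_cast
    ring
  rw [hden, Complex.real_smul, ← mul_div_assoc, mul_div_mul_left _ _ hl']

/-- As tempered distributions, `ρ(lx)/(x ± i0)` converges to
`(∫ ρ(v)/(v ± i0) dv) δ(x)` as `l → +∞`. All the indicated `ε → 0⁺` limits exist. -/
theorem scaled_rho_div_x_tendsto_delta (s : ℝ) (hs : s = 1 ∨ s = -1)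
    (ρ φ : SchwartzMap ℝ ℂ) :
    ∃ (C : ℂ) (F : ℝ → ℂ),
      Tendsto (fun ε : ℝ => ∫ v : ℝ, ρ v / ((v : ℂ) + (s : ℂ) * Complex.I * (ε : ℂ)))
        (nhdsWithin 0 (Set.Ioi 0)) (nhds C) ∧
      (∀ l : ℝ,
        Tendsto (fun ε : ℝ =>
            ∫ x : ℝ, (ρ (l * x) / ((x : ℂ) + (s : ℂ) * Complex.I * (ε : ℂ))) * φ x)
          (nhdsWithin 0 (Set.Ioi 0)) (nhds (F l))) ∧
      Tendsto F atTop (nhds (C * φ 0)) := by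
  obtain ⟨R, hR0, hR⟩ := ρ.exists_norm_sub_apply_zero_le
  obtain ⟨M, hM0, hM⟩ := φ.exists_norm_sub_apply_zero_le
  obtain ⟨B, hB0, hB⟩ := ρ.exists_norm_le
  have hmul (l : ℝ) : Integrable fun x : ℝ => ρ (l * x) * φ x :=
    φ.integrable.bdd_mul (by fun_prop) (ae_of_all _ fun x => hB (l * x))
  have hlip (l v : ℝ) :
      ‖ρ (l * v) * φ v - ρ (l * 0) * φ 0‖ ≤ (B * M + R * |l| * ‖φ 0‖) * |v| := by
    calc ‖ρ (l * v) * φ v - ρ (l * 0) * φ 0‖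
        = ‖ρ (l * v) * (φ v - φ 0) + (ρ (l * v) - ρ 0) * φ 0‖ := by
          rw [mul_zero]
          congr 1
          ring
      _ ≤ B * (M * |v|) + R * |l * v| * ‖φ 0‖ := by
          refine (norm_add_le _ _).trans ?_
          rw [norm_mul, norm_mul]
          gcongr
          exacts [hB _, hM _, hR _]
      _ = (B * M + R * |l| * ‖φ 0‖) * |v| := by
          rw [abs_mul]
          ring
  obtain ⟨C, hC⟩ := exists_tendsto_integral_div_add_mul_I_mul hs ρ.integrable hR
  choose F hF using fun l =>
    exists_tendsto_integral_div_add_mul_I_mul hs (hmul l) (hlip l)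
  refine ⟨C, F, hC, fun l => ?_, ?_⟩
  · simpa only [div_mul_eq_mul_div] using hF l
  have hbound (l : ℝ) (hl : 0 < l) : ‖F l - C * φ 0‖ ≤ l⁻¹ * (M * ∫ v, ‖ρ v‖) := by
    have hscale : Tendsto (fun ε : ℝ => l * ε) (nhdsWithin 0 (Set.Ioi 0))
        (nhdsWithin 0 (Set.Ioi 0)) := by
      refine tendsto_nhdsWithin_iff.2 ⟨?_, ?_⟩
      · simpa using ((continuous_const_mul l).tendsto 0).mono_left nhdsWithin_le_nhds
      · filter_upwards [self_mem_nhdsWithin] with ε hε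
        exact mul_pos hl hε
    refine le_of_tendsto ((hF l).sub ((hC.comp hscale).mul_const (φ 0))).norm ?_
    filter_upwards [self_mem_nhdsWithin] with ε hε
    have hρl : Integrable fun x : ℝ => ρ (l * x) := ρ.integrable.comp_mul_left' hl.ne'
    rw [Function.comp_apply, ← integral_comp_mul_left_div_add_mul_I_mul s ρ hl ε,
      ← integral_mul_const, ← integral_sub ((hmul l).div_add_mul_I_mul hs hε)
        ((hρl.div_add_mul_I_mul hs hε).mul_const _)]
    have hscaled : ∫ x : ℝ, M * ‖ρ (l * x)‖ = l⁻¹ * (M * ∫ v, ‖ρ v‖) := by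
      rw [integral_const_mul, Measure.integral_comp_mul_left (fun v => ‖ρ v‖),
        abs_of_pos (inv_pos.2 hl), smul_eq_mul]
      ring
    rw [← hscaled]
    refine norm_integral_le_of_norm_le (hρl.norm.const_mul M) (ae_of_all _ fun x => ?_)
    have hpos := norm_pos_iff.2 (add_mul_I_mul_ne_zero hs x hε)
    rw [div_mul_eq_mul_div, ← sub_div, ← mul_sub, norm_div, norm_mul, div_le_iff₀ hpos]
    calc ‖ρ (l * x)‖ * ‖φ x - φ 0‖ ≤ ‖ρ (l * x)‖ * (M * |x|) := by
          gcongr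
          exact hM x
      _ = M * ‖ρ (l * x)‖ * |x| := by ring
      _ ≤ M * ‖ρ (l * x)‖ * ‖(x : ℂ) + (s : ℂ) * Complex.I * (ε : ℂ)‖ := by
          gcongr
          exact abs_le_norm_add_mul_I_mul s x ε
  refine tendsto_iff_norm_sub_tendsto_zero.2 (squeeze_zero' (.of_forall fun _ => norm_nonneg _)
    (eventually_gt_atTop 0 |>.mono hbound) ?_)
  simpa using tendsto_inv_atTop_zero.mul_const (M * ∫ v, ‖ρ v‖)
end

section
/- Fix a sign s ∈ {+1, −1}. For all complex-valued Schwartz functions ρ₁, ρ₂, ρ₃ on ℝ and every complex-valued Schwartz function φ on ℝ², lim_{l→+∞} lim_{ε→0⁺} ∫_{ℝ²} (ρ₁(lx) ρ₂(ly) ρ₃(l(x−y)) / ((x + s·iε)(y + s·iε))) φ(x,y) dx dy = (lim_{ε→0⁺} ∫_{ℝ²} ρ₁(u) ρ₂(v) ρ₃(u−v) / ((u + s·iε)(v + s·iε)) du dv) · φ(0,0), all the indicated limits existing. In other words, as tempered distributions in (x,y), ρ₁(lx)ρ₂(ly)ρ₃(l(x−y))/((x±i0)(y±i0)) converges to the constant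 ∫∫ ρ₁(u)ρ₂(v)ρ₃(u−v)/((u±i0)(v±i0)) du dv times δ(x)δ(y) as l → +∞. -/
open MeasureTheory Filter

open scoped SchwartzMap FourierTransform

/-- The Schwartz function `(x, y) ↦ f x * g y` on the plane. -/
noncomputable def SchwartzMap.tensorMul (f g : 𝓢(ℝ, ℂ)) : 𝓢(ℝ × ℝ, ℂ) where
  toFun p := f p.1 * g p.2
  smooth' := (f.smooth'.comp contDiff_fst).mul (g.smooth'.comp contDiff_snd)
  decay' k n := by
    have hf : ∀ (i : ℕ) (p : ℝ × ℝ),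
        ‖iteratedFDeriv ℝ i (fun p : ℝ × ℝ => f p.1) p‖ ≤ ‖iteratedFDeriv ℝ i f p.1‖ := by
      intro i p
      have h := (ContinuousLinearMap.fst ℝ ℝ ℝ).iteratedFDeriv_comp_right (f.smooth i) p le_rfl
      refine (congrArg norm h).trans_le
        ((ContinuousMultilinearMap.norm_compContinuousLinearMap_le _ _).trans ?_)
      refine mul_le_of_le_one_right (norm_nonneg _)
        (Finset.prod_le_one (fun _ _ => norm_nonneg _) fun _ _ => ?_)
      exact ContinuousLinearMap.norm_fst_le ℝ ℝ ℝ
    have hg : ∀ (i : ℕ) (p : ℝ × ℝ),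
        ‖iteratedFDeriv ℝ i (fun p : ℝ × ℝ => g p.2) p‖ ≤ ‖iteratedFDeriv ℝ i g p.2‖ := by
      intro i p
      have h := (ContinuousLinearMap.snd ℝ ℝ ℝ).iteratedFDeriv_comp_right (g.smooth i) p le_rfl
      refine (congrArg norm h).trans_le
        ((ContinuousMultilinearMap.norm_compContinuousLinearMap_le _ _).trans ?_)
      refine mul_le_of_le_one_right (norm_nonneg _)
        (Finset.prod_le_one (fun _ _ => norm_nonneg _) fun _ _ => ?_)
      exact ContinuousLinearMap.norm_snd_le ℝ ℝ ℝ
    choose A hA using f.decay'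
    choose B hB using g.decay'
    refine ⟨∑ i ∈ Finset.range (n + 1), (n.choose i : ℝ) *
      (A k i * B 0 (n - i) + A 0 i * B k (n - i)), fun p => ?_⟩
    have hmul := norm_iteratedFDeriv_mul_le (𝕜 := ℝ) (N := n)
      ((f.smooth n).comp contDiff_fst) ((g.smooth n).comp contDiff_snd) p le_rfl
    refine (mul_le_mul_of_nonneg_left hmul (by positivity)).trans ?_
    rw [Finset.mul_sum]
    refine Finset.sum_le_sum fun i _ => ?_
    have hp : ‖p‖ ^ k ≤ ‖p.1‖ ^ k + ‖p.2‖ ^ k := by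
      rcases max_cases ‖p.1‖ ‖p.2‖ with h | h
      · rw [Prod.norm_def, h.1]; exact le_add_of_nonneg_right (by positivity)
      · rw [Prod.norm_def, h.1]; exact le_add_of_nonneg_left (by positivity)
    have a1 := hA k i p.1
    have a0 := hA 0 i p.1
    have b1 := hB k (n - i) p.2
    have b0 := hB 0 (n - i) p.2
    rw [pow_zero, one_mul] at a0 b0
    have e : ‖p‖ ^ k * ((n.choose i : ℝ) * ‖iteratedFDeriv ℝ i f p.1‖ *
        ‖iteratedFDeriv ℝ (n - i) g p.2‖) ≤ (n.choose i : ℝ) *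
          ((‖p.1‖ ^ k * ‖iteratedFDeriv ℝ i f p.1‖) * ‖iteratedFDeriv ℝ (n - i) g p.2‖ +
          ‖iteratedFDeriv ℝ i f p.1‖ * (‖p.2‖ ^ k * ‖iteratedFDeriv ℝ (n - i) g p.2‖)) := by
      refine (mul_le_mul_of_nonneg_right hp (by positivity)).trans_eq ?_
      ring
    refine le_trans ?_ (e.trans ?_)
    · gcongr
      · exact hf i p
      · exact hg (n - i) p
    · gcongr
      · exact (by positivity : (0 : ℝ) ≤ _).trans a1
      · exact a1
      · exact b0
      · exact (norm_nonneg _).trans a0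
      · exact a0
      · exact b1

/-- The character `p ↦ exp (2πi q · p)` of the plane. -/
noncomputable def planeChar (q p : ℝ × ℝ) : ℂ :=
  Complex.exp (((2 * Real.pi * (q.1 * p.1 + q.2 * p.2) : ℝ) : ℂ) * Complex.I)

lemma norm_planeChar (q p : ℝ × ℝ) : ‖planeChar q p‖ = 1 :=
  Complex.norm_exp_ofReal_mul_I _

@[fun_prop]
lemma Continuous.planeChar {X : Type*} [TopologicalSpace X] {f g : X → ℝ × ℝ}
    (hf : Continuous f) (hg : Continuous g) : Continuous fun x => planeChar (f x) (g x) := by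
  unfold _root_.planeChar
  fun_prop

lemma planeChar_sub_smul (ξ η p : ℝ × ℝ) (c : ℝ) :
    planeChar (ξ - c • η) p = planeChar ξ p * planeChar (-η) (c • p) := by
  unfold planeChar
  rw [← Complex.exp_add, ← add_mul, ← Complex.ofReal_add]
  congr 3
  simp
  ring

/-- Fourier inversion for Schwartz functions on `ℝ × ℝ`. -/
lemma SchwartzMap.exists_planeFourier (ψ : 𝓢(ℝ × ℝ, ℂ)) :
    ∃ G : 𝓢(ℝ × ℝ, ℂ), (∀ q, G q = ∫ p, planeChar q p * ψ p) ∧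
      ∀ p, ψ p = ∫ q, planeChar (-q) p * G q := by
  let e : WithLp 2 (ℝ × ℝ) ≃L[ℝ] ℝ × ℝ := WithLp.prodContinuousLinearEquiv 2 ℝ ℝ ℝ
  have hvol : ∀ f : WithLp 2 (ℝ × ℝ) → ℂ, ∫ v, f v = ∫ p : ℝ × ℝ, f (e.symm p) := fun f =>
    ((WithLp.volume_preserving_toLp ℝ ℝ).integral_comp
      (MeasurableEquiv.toLp 2 (ℝ × ℝ)).measurableEmbedding f).symm
  let f : 𝓢(WithLp 2 (ℝ × ℝ), ℂ) := SchwartzMap.compCLMOfContinuousLinearEquiv ℂ e ψ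
  let G : 𝓢(ℝ × ℝ, ℂ) := SchwartzMap.compCLMOfContinuousLinearEquiv ℂ e.symm (𝓕⁻ f)
  refine ⟨G, fun q => ?_, fun p => ?_⟩
  · have : G q = 𝓕⁻ (f : WithLp 2 (ℝ × ℝ) → ℂ) (e.symm q) := by
      rw [← SchwartzMap.fourierInv_coe]; rfl
    rw [this, Real.fourierInv_eq', hvol]
    refine integral_congr_ae (.of_forall fun p => ?_)
    simp [f, e, planeChar, WithLp.prod_inner_apply]
  · have : ψ p = 𝓕 (𝓕⁻ f) (e.symm p) := by
      rw [FourierTransform.fourier_fourierInv_eq]; simp [f]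
    rw [this, SchwartzMap.fourier_coe, Real.fourier_eq', hvol]
    refine integral_congr_ae (.of_forall fun q => ?_)
    simp [G, e, planeChar, WithLp.prod_inner_apply]
    left
    congr 1
    ring

lemma integral_Ioi_exp_mul_exp {s ε : ℝ} (hs : s * s = 1) (hε : 0 < ε) (x : ℝ) :
    ∫ a in Set.Ioi (0 : ℝ), (Complex.exp (((-(2 * Real.pi * ε) : ℝ) +
      ((2 * Real.pi * s * x : ℝ) : ℂ) * Complex.I) * a)) =
      1 / (-(2 * Real.pi * s * Complex.I) * (x + s * Complex.I * ε)) := by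
  have hπ := Real.pi_pos
  rw [integral_exp_mul_complex_Ioi (by simp; positivity)]
  have hs' : (s : ℂ) * s = 1 := by exact_mod_cast hs
  rw [Complex.ofReal_zero, mul_zero, Complex.exp_zero, neg_div, ← div_neg]
  congr 1
  push_cast
  linear_combination (2 * Real.pi * ε * (s : ℂ) ^ 2) * (Complex.I_sq) - 2 * Real.pi * ε * hs'

/-- The open positive quadrant of the plane. -/
def openQuadrant : Set (ℝ × ℝ) := Set.Ioi 0 ×ˢ Set.Ioi 0

lemma measurableSet_openQuadrant : MeasurableSet openQuadrant :=
  measurableSet_Ioi.prod measurableSet_Ioi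

lemma integrableOn_exp_openQuadrant {ε : ℝ} (hε : 0 < ε) :
    IntegrableOn (fun q : ℝ × ℝ => ((Real.exp (-(2 * Real.pi * ε) * (q.1 + q.2)) : ℝ) : ℂ))
      openQuadrant := by
  have h := exp_neg_integrableOn_Ioi 0 (by have := Real.pi_pos; positivity : 0 < 2 * Real.pi * ε)
  have h2 := Integrable.mul_prod h h
  rw [Measure.prod_restrict] at h2
  simp_rw [← Real.exp_add, ← mul_add] at h2
  exact h2.ofReal

lemma one_div_mul_eq_integral {s ε : ℝ} (hs : s * s = 1) (hε : 0 < ε) (p : ℝ × ℝ) :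
    1 / (((p.1 : ℂ) + s * Complex.I * ε) * ((p.2 : ℂ) + s * Complex.I * ε)) =
      -(4 * Real.pi ^ 2) * ∫ q in openQuadrant,
        ((Real.exp (-(2 * Real.pi * ε) * (q.1 + q.2)) : ℝ) : ℂ) * planeChar (s • q) p := by
  have hs' : (s : ℂ) * s = 1 := by exact_mod_cast hs
  have hπ : (Real.pi : ℂ) ≠ 0 := by exact_mod_cast Real.pi_pos.ne'
  have h := setIntegral_prod_mul (μ := volume) (ν := volume)
    (fun a : ℝ => Complex.exp (((-(2 * Real.pi * ε) : ℝ) +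
      ((2 * Real.pi * s * p.1 : ℝ) : ℂ) * Complex.I) * a))
    (fun a : ℝ => Complex.exp (((-(2 * Real.pi * ε) : ℝ) +
      ((2 * Real.pi * s * p.2 : ℝ) : ℂ) * Complex.I) * a)) (Set.Ioi 0) (Set.Ioi 0)
  rw [integral_Ioi_exp_mul_exp hs hε, integral_Ioi_exp_mul_exp hs hε] at h
  have h' : (∫ q in openQuadrant,
        ((Real.exp (-(2 * Real.pi * ε) * (q.1 + q.2)) : ℝ) : ℂ) * planeChar (s • q) p) =
      ∫ z : ℝ × ℝ in Set.Ioi 0 ×ˢ Set.Ioi 0, Complex.exp (((-(2 * Real.pi * ε) : ℝ) +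
      ((2 * Real.pi * s * p.1 : ℝ) : ℂ) * Complex.I) * z.1) *
        Complex.exp (((-(2 * Real.pi * ε) : ℝ) +
      ((2 * Real.pi * s * p.2 : ℝ) : ℂ) * Complex.I) * z.2) ∂volume.prod volume := by
    refine integral_congr_ae (.of_forall fun q => ?_)
    simp only [planeChar, Complex.ofReal_exp]
    rw [← Complex.exp_add, ← Complex.exp_add]
    congr 1
    simp
    ring
  rw [h', h, div_mul_div_comm, mul_div_assoc', one_mul, mul_one]
  rw [mul_mul_mul_comm (-(2 * (Real.pi : ℂ) * s * Complex.I))]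
  have e : -(2 * (Real.pi : ℂ) * s * Complex.I) * -(2 * (Real.pi : ℂ) * s * Complex.I) =
      -(4 * Real.pi ^ 2) := by
    linear_combination (4 * (Real.pi : ℂ) ^ 2 * s * s) * Complex.I_sq - 4 * (Real.pi : ℂ) ^ 2 * hs'
  rw [e, div_mul_cancel_left₀ (by simp [hπ]), one_div]

lemma integral_div_mul_eq {s ε : ℝ} (hs : s * s = 1) (hε : 0 < ε) {ψ G : ℝ × ℝ → ℂ}
    (hψ : Integrable ψ) (hG : ∀ q, G q = ∫ p, planeChar q p * ψ p) :
    ∫ p : ℝ × ℝ, ψ p / (((p.1 : ℂ) + s * Complex.I * ε) * ((p.2 : ℂ) + s * Complex.I * ε)) =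
      -(4 * Real.pi ^ 2) * ∫ q in openQuadrant,
        ((Real.exp (-(2 * Real.pi * ε) * (q.1 + q.2)) : ℝ) : ℂ) * G (s • q) := by
  have hF : Integrable (fun z : (ℝ × ℝ) × (ℝ × ℝ) => planeChar (s • z.2) z.1 *
      (ψ z.1 * ((Real.exp (-(2 * Real.pi * ε) * (z.2.1 + z.2.2)) : ℝ) : ℂ)))
      (volume.prod (volume.restrict openQuadrant)) := by
    refine (hψ.mul_prod (integrableOn_exp_openQuadrant hε)).bdd_mul (c := 1)
      (by fun_prop) (.of_forall fun z => (norm_planeChar _ _).le)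
  calc _ = ∫ p : ℝ × ℝ, -(4 * Real.pi ^ 2) * ∫ q in openQuadrant, planeChar (s • q) p *
        (ψ p * ((Real.exp (-(2 * Real.pi * ε) * (q.1 + q.2)) : ℝ) : ℂ)) := by
        refine integral_congr_ae (.of_forall fun p => ?_)
        simp only
        rw [div_eq_mul_one_div, one_div_mul_eq_integral hs hε, mul_left_comm,
          ← integral_const_mul]
        congr 1
        refine integral_congr_ae (.of_forall fun q => ?_)
        simp only
        ring
    _ = _ := by
        rw [integral_const_mul, integral_integral_swap hF]
        congr 1
        refine integral_congr_ae (.of_forall fun q => ?_)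
        simp only
        rw [hG, ← integral_const_mul]
        refine integral_congr_ae (.of_forall fun p => ?_)
        simp only
        ring

lemma tendsto_integral_div_mul {s : ℝ} (hs : s * s = 1) (ψ G : 𝓢(ℝ × ℝ, ℂ))
    (hG : ∀ q, G q = ∫ p, planeChar q p * ψ p) :
    Tendsto (fun ε : ℝ => ∫ p : ℝ × ℝ,
        ψ p / (((p.1 : ℂ) + s * Complex.I * ε) * ((p.2 : ℂ) + s * Complex.I * ε)))
      (nhdsWithin 0 (Set.Ioi 0))
      (nhds (-(4 * Real.pi ^ 2) * ∫ q in openQuadrant, G (s • q))) := by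
  have hs0 : s ≠ 0 := fun h => by simp [h] at hs
  have hpos : ∀ᶠ ε in nhdsWithin (0 : ℝ) (Set.Ioi 0), 0 < ε := self_mem_nhdsWithin
  refine Tendsto.congr' (hpos.mono fun ε hε => (integral_div_mul_eq hs hε ψ.integrable hG).symm)
    (Tendsto.const_mul _ ?_)
  have hGs : Integrable fun q : ℝ × ℝ => G (s • q) := G.integrable.comp_smul hs0
  refine tendsto_integral_filter_of_dominated_convergence (fun q => ‖G (s • q)‖)
    (.of_forall fun ε => by fun_prop) ?_ hGs.norm.integrableOn (.of_forall fun q => ?_)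
  · refine hpos.mono fun ε hε => ?_
    filter_upwards [ae_restrict_mem measurableSet_openQuadrant] with q hq
    rw [norm_mul]
    refine mul_le_of_le_one_left (norm_nonneg _) ?_
    rw [Complex.norm_real, Real.norm_of_nonneg (Real.exp_pos _).le, Real.exp_le_one_iff]
    have h1 : 0 < q.1 := hq.1
    have h2 : 0 < q.2 := hq.2
    have := Real.pi_pos
    have : 0 < 2 * Real.pi * ε * (q.1 + q.2) := by positivity
    linarith
  · have : Continuous fun ε : ℝ =>
        ((Real.exp (-(2 * Real.pi * ε) * (q.1 + q.2)) : ℝ) : ℂ) * G (s • q) := by fun_prop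
    have h := (this.tendsto 0).mono_left (nhdsWithin_le_nhds (s := Set.Ioi 0))
    simpa using h

lemma planeFourier_mul_dilate {g Gg φ Gφ : ℝ × ℝ → ℂ} (hg : Integrable g) (hGφ : Integrable Gφ)
    (hGg : ∀ q, Gg q = ∫ p, planeChar q p * g p)
    (hφ : ∀ p, φ p = ∫ q, planeChar (-q) p * Gφ q) (c : ℝ) (ξ : ℝ × ℝ) :
    ∫ p, planeChar ξ p * (g p * φ (c • p)) = ∫ η, Gφ η * Gg (ξ - c • η) := by
  have hF : Integrable (fun z : (ℝ × ℝ) × (ℝ × ℝ) => planeChar (ξ - c • z.2) z.1 *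
      (g z.1 * Gφ z.2)) (volume.prod volume) :=
    (hg.mul_prod hGφ).bdd_mul (c := 1) (Continuous.aestronglyMeasurable (by fun_prop))
      (.of_forall fun z => (norm_planeChar _ _).le)
  calc _ = ∫ p, ∫ η, planeChar (ξ - c • η) p * (g p * Gφ η) := by
        refine integral_congr_ae (.of_forall fun p => ?_)
        simp only
        rw [hφ, ← mul_assoc, ← integral_const_mul]
        refine integral_congr_ae (.of_forall fun η => ?_)
        simp only [planeChar_sub_smul]
        ring
    _ = _ := by
        rw [integral_integral_swap hF]
        refine integral_congr_ae (.of_forall fun η => ?_)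
        simp only
        rw [hGg, ← integral_const_mul]
        refine integral_congr_ae (.of_forall fun p => ?_)
        simp only
        ring

lemma setIntegral_openQuadrant_convolution {s : ℝ} (hs : s * s = 1) {Gg Gφ : ℝ × ℝ → ℂ}
    (hGg : Integrable Gg) (hGφ : Integrable Gφ) (c : ℝ) :
    ∫ ξ in openQuadrant, ∫ η, Gφ η * Gg (s • ξ - c • η) =
      ∫ z : (ℝ × ℝ) × (ℝ × ℝ), openQuadrant.indicator (fun _ => Gφ z.2 * Gg (s • z.1))
        (z.1 + c • s • z.2) := by
  have hs0 : s ≠ 0 := fun h => by simp [h] at hs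
  have hmain : Integrable (fun z : (ℝ × ℝ) × (ℝ × ℝ) =>
      openQuadrant.indicator (fun _ => Gφ z.2 * Gg (s • z.1)) (z.1 + c • s • z.2))
      (volume.prod volume) := by
    have h : Integrable (fun z : (ℝ × ℝ) × (ℝ × ℝ) => Gφ z.2 * Gg (s • z.1))
        (volume.prod volume) :=
      ((hGg.comp_smul hs0).mul_prod hGφ).congr (.of_forall fun z => mul_comm _ _)
    exact h.indicator (s := (fun z : (ℝ × ℝ) × (ℝ × ℝ) => z.1 + c • s • z.2) ⁻¹' openQuadrant)
      (measurableSet_openQuadrant.preimage (by fun_prop))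
  have hshear : MeasurePreserving (fun z : (ℝ × ℝ) × (ℝ × ℝ) => (z.1 - c • s • z.2, z.2))
      (volume.prod volume) (volume.prod volume) := by
    have := (MeasurePreserving.skew_product (μa := (volume : Measure (ℝ × ℝ)))
      (μb := (volume : Measure (ℝ × ℝ))) (μc := (volume : Measure (ℝ × ℝ)))
      (μd := (volume : Measure (ℝ × ℝ))) (f := id) (MeasurePreserving.id _)
      (g := fun η ξ => ξ - c • s • η) (by fun_prop)
      (.of_forall fun η => (measurePreserving_sub_right volume (c • s • η)).map_eq))
    exact (Measure.measurePreserving_swap.comp this).comp Measure.measurePreserving_swap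
  have hcomp := hshear.integrable_comp_of_integrable hmain
  rw [Measure.volume_eq_prod (ℝ × ℝ) (ℝ × ℝ), ← integral_indicator measurableSet_openQuadrant]
  conv_rhs => rw [← hshear.map_eq]
  rw [integral_map hshear.measurable.aemeasurable (by rw [hshear.map_eq]; exact hmain.1)]
  refine Eq.trans ?_ (integral_prod _ hcomp).symm
  refine integral_congr_ae (.of_forall fun ξ => ?_)
  have h : ∀ η : ℝ × ℝ, s • (ξ - c • s • η) = s • ξ - c • η := fun η => by
    rw [smul_sub, smul_comm s c, smul_smul s s, hs, one_smul]
  by_cases hξ : ξ ∈ openQuadrant <;> simp [hξ, h]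

lemma tendsto_setIntegral_openQuadrant_convolution {s : ℝ} (hs : s * s = 1)
    {Gg Gφ : ℝ × ℝ → ℂ} (hGg : Integrable Gg) (hGφ : Integrable Gφ) :
    Tendsto (fun c : ℝ => ∫ ξ in openQuadrant, ∫ η, Gφ η * Gg (s • ξ - c • η)) (nhds 0)
      (nhds ((∫ ξ in openQuadrant, Gg (s • ξ)) * ∫ η, Gφ η)) := by
  have hs0 : s ≠ 0 := fun h => by simp [h] at hs
  have h : Integrable (fun z : (ℝ × ℝ) × (ℝ × ℝ) => Gφ z.2 * Gg (s • z.1))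
      (volume.prod volume) :=
    ((hGg.comp_smul hs0).mul_prod hGφ).congr (.of_forall fun z => mul_comm _ _)
  simp_rw [setIntegral_openQuadrant_convolution hs hGg hGφ]
  rw [← integral_indicator measurableSet_openQuadrant, ← integral_prod_mul]
  refine tendsto_integral_filter_of_dominated_convergence (fun z => ‖Gφ z.2 * Gg (s • z.1)‖)
    (.of_forall fun c => ?_) (.of_forall fun c => .of_forall fun z => ?_) h.norm ?_
  · exact (h.indicator
      (s := (fun z : (ℝ × ℝ) × (ℝ × ℝ) => z.1 + c • s • z.2) ⁻¹' openQuadrant)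
      (measurableSet_openQuadrant.preimage (by fun_prop))).1
  · exact norm_indicator_le_norm_self (fun _ => Gφ z.2 * Gg (s • z.1)) _
  · have hne : ∀ᵐ ξ : ℝ × ℝ, ξ.1 ≠ 0 ∧ ξ.2 ≠ 0 :=
      (Measure.quasiMeasurePreserving_fst.ae (Measure.ae_ne volume 0)).and
        (Measure.quasiMeasurePreserving_snd.ae (Measure.ae_ne volume 0))
    filter_upwards [Measure.quasiMeasurePreserving_fst.ae hne] with z hz
    have hc : Tendsto (fun c : ℝ => z.1 + c • s • z.2) (nhds 0) (nhds z.1) := by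
      have : Continuous fun c : ℝ => z.1 + c • s • z.2 := by fun_prop
      simpa using this.tendsto 0
    have hev : ∀ᶠ c in nhds (0 : ℝ), (z.1 + c • s • z.2 ∈ openQuadrant ↔ z.1 ∈ openQuadrant) := by
      by_cases hz1 : z.1 ∈ openQuadrant
      · filter_upwards [hc ((isOpen_Ioi.prod isOpen_Ioi).mem_nhds hz1)] with c h1
        exact iff_of_true h1 hz1
      · have hmem : z.1 ∈ (Set.Ici (0 : ℝ) ×ˢ Set.Ici (0 : ℝ))ᶜ := by
          rintro ⟨h1, h2⟩
          exact hz1 ⟨lt_of_le_of_ne h1 hz.1.symm, lt_of_le_of_ne h2 hz.2.symm⟩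
        filter_upwards [hc ((isClosed_Ici.prod isClosed_Ici).isOpen_compl.mem_nhds hmem)]
          with c h1
        exact iff_of_false (fun h2 => h1 ⟨Set.Ioi_subset_Ici_self h2.1, Set.Ioi_subset_Ici_self h2.2⟩) hz1
    refine tendsto_const_nhds.congr' (hev.mono fun c h1 => ?_)
    by_cases hz1 : z.1 ∈ openQuadrant
    · simp [Set.indicator_of_mem (h1.2 hz1), hz1, mul_comm]
    · simp [Set.indicator_of_notMem (mt h1.1 hz1), hz1]

lemma integral_div_mul_dilate (s : ℝ) {l : ℝ} (hl : 0 < l) (ε : ℝ) (χ : ℝ × ℝ → ℂ) :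
    ∫ p : ℝ × ℝ,
        χ (l • p) / (((p.1 : ℂ) + s * Complex.I * ε) * ((p.2 : ℂ) + s * Complex.I * ε)) =
      ∫ p : ℝ × ℝ, χ p / (((p.1 : ℂ) + s * Complex.I * (l * ε : ℝ)) *
        ((p.2 : ℂ) + s * Complex.I * (l * ε : ℝ))) := by
  have hl' : (l : ℂ) ≠ 0 := by exact_mod_cast hl.ne'
  have h := Measure.integral_comp_smul (volume : Measure (ℝ × ℝ))
    (fun p : ℝ × ℝ => χ p / (((p.1 : ℂ) + s * Complex.I * (l * ε : ℝ)) *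
        ((p.2 : ℂ) + s * Complex.I * (l * ε : ℝ)))) l
  have hfin : Module.finrank ℝ (ℝ × ℝ) = 2 := by simp
  rw [hfin, abs_of_pos (by positivity), eq_inv_smul_iff₀ (by positivity), ← integral_smul] at h
  rw [← h]
  refine integral_congr_ae (.of_forall fun p => ?_)
  have e : ∀ x : ℝ, (((l * x : ℝ) : ℂ) + s * Complex.I * (l * ε : ℝ)) =
      l * (x + s * Complex.I * ε) := fun x => by push_cast; ring
  simp only [Prod.smul_fst, Prod.smul_snd, smul_eq_mul, e, Complex.real_smul]
  rw [mul_mul_mul_comm, mul_div_assoc', Complex.ofReal_pow, sq,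
    mul_div_mul_left _ _ (mul_ne_zero hl' hl')]

/-- As tempered distributions in `(x,y)`,
`ρ₁(lx)ρ₂(ly)ρ₃(l(x−y))/((x±i0)(y±i0))` converges to the constant
`∫∫ ρ₁(u)ρ₂(v)ρ₃(u−v)/((u±i0)(v±i0)) du dv` times `δ(x)δ(y)` as `l → +∞`.
All the indicated `ε → 0⁺` limits exist. -/
theorem scaled_rho_product_tendsto_delta (s : ℝ) (hs : s = 1 ∨ s = -1)
    (ρ₁ ρ₂ ρ₃ : SchwartzMap ℝ ℂ) (φ : SchwartzMap (ℝ × ℝ) ℂ) :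
    ∃ (C : ℂ) (F : ℝ → ℂ),
      Tendsto (fun ε : ℝ => ∫ p : ℝ × ℝ,
          ρ₁ p.1 * ρ₂ p.2 * ρ₃ (p.1 - p.2) /
            (((p.1 : ℂ) + (s : ℂ) * Complex.I * (ε : ℂ)) *
              ((p.2 : ℂ) + (s : ℂ) * Complex.I * (ε : ℂ))))
        (nhdsWithin 0 (Set.Ioi 0)) (nhds C) ∧
      (∀ l : ℝ,
        Tendsto (fun ε : ℝ => ∫ p : ℝ × ℝ,
            (ρ₁ (l * p.1) * ρ₂ (l * p.2) * ρ₃ (l * (p.1 - p.2)) /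
              (((p.1 : ℂ) + (s : ℂ) * Complex.I * (ε : ℂ)) *
                ((p.2 : ℂ) + (s : ℂ) * Complex.I * (ε : ℂ)))) * φ p)
          (nhdsWithin 0 (Set.Ioi 0)) (nhds (F l))) ∧
      Tendsto F atTop (nhds (C * φ (0, 0))) := by
  have hss : s * s = 1 := by rcases hs with rfl | rfl <;> norm_num
  have hsub : Function.HasTemperateGrowth fun p : ℝ × ℝ => ρ₃ (p.1 - p.2) :=
    ρ₃.hasTemperateGrowth.comp
      (ContinuousLinearMap.fst ℝ ℝ ℝ - ContinuousLinearMap.snd ℝ ℝ ℝ).hasTemperateGrowth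
  let g : 𝓢(ℝ × ℝ, ℂ) := SchwartzMap.smulLeftCLM ℂ (fun p : ℝ × ℝ => ρ₃ (p.1 - p.2))
    (ρ₁.tensorMul ρ₂)
  have hg : ∀ p, g p = ρ₁ p.1 * ρ₂ p.2 * ρ₃ (p.1 - p.2) := fun p =>
    (SchwartzMap.smulLeftCLM_apply_apply hsub _ p).trans (mul_comm _ _)
  have hdil : ∀ (f : 𝓢(ℝ × ℝ, ℂ)) (c : ℝ), Function.HasTemperateGrowth fun p => f (c • p) :=
    fun f c => f.hasTemperateGrowth.comp
      (c • ContinuousLinearMap.id ℝ (ℝ × ℝ)).hasTemperateGrowth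
  let ψ : ℝ → 𝓢(ℝ × ℝ, ℂ) := fun l => SchwartzMap.smulLeftCLM ℂ (fun p => g (l • p)) φ
  let χ : ℝ → 𝓢(ℝ × ℝ, ℂ) := fun c => SchwartzMap.smulLeftCLM ℂ (fun p => φ (c • p)) g
  have hψ : ∀ l p, ψ l p = g (l • p) * φ p := fun l p =>
    SchwartzMap.smulLeftCLM_apply_apply (hdil g l) _ p
  have hχ : ∀ c p, χ c p = g p * φ (c • p) := fun c p =>
    (SchwartzMap.smulLeftCLM_apply_apply (hdil φ c) _ p).trans (mul_comm _ _)
  obtain ⟨Gg, hGg, -⟩ := g.exists_planeFourier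
  obtain ⟨Gφ, -, hφ⟩ := φ.exists_planeFourier
  choose Gψ hGψ _ using fun l => (ψ l).exists_planeFourier
  choose Gχ hGχ _ using fun c => (χ c).exists_planeFourier
  refine ⟨-(4 * Real.pi ^ 2) * ∫ q in openQuadrant, Gg (s • q),
    fun l => -(4 * Real.pi ^ 2) * ∫ q in openQuadrant, Gψ l (s • q), ?_, fun l => ?_, ?_⟩
  · have h := tendsto_integral_div_mul hss g Gg hGg
    simp_rw [hg] at h
    exact h
  · refine (tendsto_integral_div_mul hss (ψ l) (Gψ l) (hGψ l)).congr fun ε => ?_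
    refine integral_congr_ae (.of_forall fun p => ?_)
    simp only [hψ, hg, Prod.smul_fst, Prod.smul_snd, smul_eq_mul, mul_sub]
    ring
  have hconv := tendsto_setIntegral_openQuadrant_convolution hss Gg.integrable Gφ.integrable
  have hφ0 : φ (0, 0) = ∫ η, Gφ η := by
    rw [hφ]
    simp [planeChar]
  rw [hφ0, mul_assoc]
  refine ((hconv.comp tendsto_inv_atTop_zero).const_mul (-(4 * Real.pi ^ 2 : ℂ))).congr' ?_
  filter_upwards [eventually_gt_atTop 0] with l hl
  have hscale : Tendsto (fun ε : ℝ => l * ε) (nhdsWithin 0 (Set.Ioi 0))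
      (nhdsWithin 0 (Set.Ioi 0)) := by
    refine tendsto_nhdsWithin_iff.2 ⟨?_, ?_⟩
    · have : Tendsto (fun ε : ℝ => l * ε) (nhds 0) (nhds (l * 0)) :=
        (continuous_const_mul l).tendsto 0
      rw [mul_zero] at this
      exact this.mono_left nhdsWithin_le_nhds
    · filter_upwards [self_mem_nhdsWithin] with ε hε using mul_pos hl hε
  have hlim := (tendsto_integral_div_mul hss (χ l⁻¹) (Gχ l⁻¹) (hGχ l⁻¹)).comp hscale
  have heq : -(4 * Real.pi ^ 2 : ℂ) * ∫ q in openQuadrant, Gχ l⁻¹ (s • q) =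
      -(4 * Real.pi ^ 2) * ∫ q in openQuadrant, Gψ l (s • q) := by
    refine tendsto_nhds_unique (hlim.congr fun ε => ?_)
      (tendsto_integral_div_mul hss (ψ l) (Gψ l) (hGψ l))
    refine (integral_div_mul_dilate s hl ε (χ l⁻¹)).symm.trans ?_
    simp only [hψ, hχ, inv_smul_smul₀ hl.ne']
  rw [← heq]
  simp only [Function.comp_apply, hGχ, hχ,
    planeFourier_mul_dilate g.integrable Gφ.integrable hGg hφ]
end
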